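/- arXiv:1904.07281 — 3 statements merged into one kernel-verified Lean document; each statement's English description precedes it below -/
import Mathlib

section
/- Let k be an algebraically closed field and let A be a commutative domain that is a finitely generated k-algebra of Krull dimension at most one (for affine commutative domains the Krull dimension equals the Gelfand–Kirillov dimension). If A is not isomorphic to the polynomial ring k[t] as a k-algebra, then A is strongly retractable and, consequently, strongly cancellative. -/
open scoped TensorProduct

universe u

/-- A `k`-algebra `A` is strongly cancellative if for every `n ≥ 1` and every `k`-algebra
`B`, every `k`-algebra isomorphism `A ⊗[k] k[t₁,…,tₙ] ≅ B ⊗[k] k[t₁,…,tₙ]` implies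
`A ≅ B` as `k`-algebras. -/
def StronglyCancellative (k : Type u) [Field k] (A : Type u) [Ring A] [Algebra k A] : Prop :=
  ∀ (n : ℕ), 1 ≤ n → ∀ (B : Type u) [Ring B] [Algebra k B],
    Nonempty ((A ⊗[k] MvPolynomial (Fin n) k) ≃ₐ[k] (B ⊗[k] MvPolynomial (Fin n) k)) →
    Nonempty (A ≃ₐ[k] B)

/-- A `k`-algebra `A` is strongly retractable if for every `n ≥ 1`, every `k`-algebra `B`
and every `k`-algebra isomorphism `φ : A ⊗[k] k[t₁,…,tₙ] ≅ B ⊗[k] k[t₁,…,tₙ]`, `φ` maps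
the subalgebra `A ⊗ 1` onto the subalgebra `B ⊗ 1`. -/
def StronglyRetractable (k : Type u) [Field k] (A : Type u) [Ring A] [Algebra k A] : Prop :=
  ∀ (n : ℕ), 1 ≤ n → ∀ (B : Type u) [Ring B] [Algebra k B]
    (φ : (A ⊗[k] MvPolynomial (Fin n) k) ≃ₐ[k] (B ⊗[k] MvPolynomial (Fin n) k)),
    Subalgebra.map φ.toAlgHom
        (Algebra.TensorProduct.includeLeft (R := k) (S := k) (A := A)
          (B := MvPolynomial (Fin n) k)).range =
      (Algebra.TensorProduct.includeLeft (R := k) (S := k) (A := B)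
        (B := MvPolynomial (Fin n) k)).range

open Polynomial in
/-- An algebra homomorphism to `k[X]` with a nonconstant value is integral. -/
theorem isIntegral_of_natDegree_pos {k R : Type*} [Field k] [CommRing R] [Algebra k R]
    (f : R →ₐ[k] k[X]) {r : R} (hr : 0 < (f r).natDegree) : f.toRingHom.IsIntegral := by
  have hX : f.toRingHom.IsIntegralElem X := by
    have h0 : f r ≠ 0 := by rintro h; simp [h] at hr
    let q : k[X] := f r * C (f r).leadingCoeff⁻¹
    have hq : q.Monic := monic_mul_leadingCoeff_inv h0
    have hqd : q.natDegree = (f r).natDegree :=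
      natDegree_mul_leadingCoeff_inv _ h0
    have hfq : f (r * algebraMap k R (f r).leadingCoeff⁻¹) = q := by
      rw [map_mul, f.commutes]; rfl
    have : Nontrivial R := f.toRingHom.domain_nontrivial
    refine ⟨q.map (algebraMap k R) - C (r * algebraMap k R (f r).leadingCoeff⁻¹), ?_, ?_⟩
    · apply (hq.map _).sub_of_left
      refine lt_of_le_of_lt degree_C_le ?_
      rw [hq.degree_map]
      exact natDegree_pos_iff_degree_pos.mp (hqd ▸ hr)
    · rw [eval₂_sub, eval₂_C, eval₂_map]
      change _ - f _ = 0
      rw [hfq, sub_eq_zero]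
      have : f.toRingHom.comp (algebraMap k R) = C := by
        ext x; simp
      rw [this, eval₂_C_X]
  intro p
  induction p using Polynomial.induction_on' with
  | add p q hp hq => exact hp.add _ hq
  | monomial n a =>
    rw [← C_mul_X_pow_eq_monomial]
    refine RingHom.IsIntegralElem.mul _ ?_ 
      (@IsIntegral.pow R k[X] _ _ f.toRingHom.toAlgebra X hX n)
    have : C a = f.toRingHom (algebraMap k R a) := by simp
    rw [this]
    exact RingHom.isIntegralElem_map _

open Polynomial in
theorem coeff_coeff_swap {R : Type*} [CommSemiring R] (P : R[X][X]) (i j : ℕ) :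
    ((Bivariate.swap P).coeff i).coeff j = (P.coeff j).coeff i := by
  induction P using Polynomial.induction_on' with
  | add p q hp hq => simp [hp, hq]
  | monomial n p =>
    induction p using Polynomial.induction_on' with
    | add p q hp hq => simp [hp, hq]
    | monomial m r =>
      rw [Bivariate.swap_monomial_monomial]
      simp only [coeff_monomial]
      split_ifs <;> simp_all [coeff_monomial]

open Polynomial in
/-- If a polynomial in `T` over `k[X]` divides `p(T) - p(X)` and has `p` as a coefficient,
then it is `p(T) - p(X)` up to a unit. -/
theorem dvd_of_dvd_of_coeff_eq {k : Type*} [Field k] {p : k[X]} (hp : 0 < p.natDegree)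
    {F : k[X][X]} (hF : F ∣ p.map C - C p) {i : ℕ} (hi : F.coeff i = p) :
    p.map C - C p ∣ F := by
  obtain ⟨Q, hQ⟩ := hF
  have hsw : Bivariate.swap (p.map C - C p) = C p - p.map C := by
    rw [map_sub, Bivariate.swap_C, Bivariate.swap_map_C]
  have hdeg : (C p - p.map C : k[X][X]).natDegree = p.natDegree := by
    rw [natDegree_sub, natDegree_sub_C, natDegree_map_eq_of_injective (C_injective)]
  have hlc : IsUnit (C p - p.map C : k[X][X]).leadingCoeff := by
    rw [leadingCoeff, hdeg, coeff_sub, coeff_C, if_neg hp.ne', coeff_map, zero_sub]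
    refine IsUnit.neg (IsUnit.map C (IsUnit.mk0 _ ?_))
    rw [coeff_natDegree]
    exact leadingCoeff_ne_zero.mpr (by rintro rfl; simp at hp)
  have hmul : C p - p.map C = Bivariate.swap F * Bivariate.swap Q := by
    rw [← hsw, hQ, map_mul]
  have hne : (C p - p.map C : k[X][X]) ≠ 0 := by
    intro h; rw [h] at hlc; simp at hlc
  have hF0 : Bivariate.swap F ≠ 0 := by rintro h; simp [h] at hmul; exact hne hmul
  have hQ0 : Bivariate.swap Q ≠ 0 := by rintro h; simp [h] at hmul; exact hne hmul
  have hFd : p.natDegree ≤ (Bivariate.swap F).natDegree := by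
    apply le_natDegree_of_ne_zero
    intro h
    have := coeff_coeff_swap F p.natDegree i
    rw [h, hi, coeff_natDegree, coeff_zero] at this
    rw [leadingCoeff_eq_zero.mp this.symm] at hp
    simp at hp
  have hQd : (Bivariate.swap Q).natDegree = 0 := by
    have := natDegree_mul hF0 hQ0
    rw [← hmul, hdeg] at this
    omega
  have hQu : IsUnit (Bivariate.swap Q) := by
    rw [eq_C_of_natDegree_eq_zero hQd]
    rw [hmul, leadingCoeff_mul] at hlc
    have := isUnit_of_mul_isUnit_right hlc
    rw [leadingCoeff, hQd] at this
    exact this.map C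
  have hQu' : IsUnit Q := by
    have := hQu.map (Bivariate.swap (R := k))
    rwa [Bivariate.swap_swap_apply] at this
  rw [hQ]
  exact hQu'.mul_right_dvd.mpr dvd_rfl

open Polynomial in
/-- A subalgebra of `k[X]` that is closed under exact division is integrally closed. -/
theorem isIntegrallyClosed_of_closed_under_division {k : Type*} [Field k]
    (D : Subalgebra k k[X]) (hD : ∀ f g, f ∈ D → f ≠ 0 → f * g ∈ D → g ∈ D) :
    IsIntegrallyClosed D := by
  rw [isIntegrallyClosed_iff (FractionRing D)]
  intro x hx
  obtain ⟨a, b, hb, rfl⟩ := IsFractionRing.div_surjective (A := D) x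
  have hb0 : b ≠ 0 := nonZeroDivisors.ne_zero hb
  have hinj : Function.Injective
      ((algebraMap k[X] (FractionRing k[X])).comp (algebraMap D k[X])) :=
    (IsFractionRing.injective k[X] (FractionRing k[X])).comp Subtype.val_injective
  let ι : FractionRing D →+* FractionRing k[X] := IsFractionRing.lift hinj
  have hι : ∀ y : D, ι (algebraMap D _ y) = algebraMap k[X] _ (y : k[X]) := fun y =>
    IsFractionRing.lift_algebraMap hinj y
  obtain ⟨P, hP, hPx⟩ := hx
  have hint : IsIntegral k[X] (ι (algebraMap D _ a / algebraMap D _ b)) := by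
    refine ⟨P.map (algebraMap D k[X]), hP.map _, ?_⟩
    rw [eval₂_map, ← map_zero ι, ← hPx, hom_eval₂]
    congr 1
    ext y
    exact (hι y).symm
  obtain ⟨h, hh⟩ := IsIntegrallyClosed.isIntegral_iff.mp hint
  have hb1 : (algebraMap k[X] (FractionRing k[X])) (b : k[X]) ≠ 0 := by
    simpa using hb0
  rw [map_div₀, hι, hι, eq_div_iff hb1, ← map_mul] at hh
  have hba : (b : k[X]) * h = a := by
    rw [mul_comm]; exact IsFractionRing.injective k[X] (FractionRing k[X]) hh
  have hmem : h ∈ D := hD b h b.2 (by simpa using hb0) (hba ▸ a.2)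
  refine ⟨⟨h, hmem⟩, ?_⟩
  rw [eq_div_iff (by simpa using hb0), ← map_mul]
  congr 1
  ext1
  simpa [mul_comm] using hba

open Polynomial in
/-- A form of Lüroth's theorem: a subalgebra of `k[X]` that is closed under exact division and
is not reduced to constants is generated by one element. -/
theorem exists_generator_of_closed_under_division {k : Type*} [Field k]
    (D : Subalgebra k k[X]) (hD : ∀ f g, f ∈ D → f ≠ 0 → f * g ∈ D → g ∈ D)
    {q : k[X]} (hq : q ∈ D) (hq0 : 0 < q.natDegree) :
    ∃ p ∈ D, 0 < p.natDegree ∧ ∀ a ∈ D, ∃ P : k[X], aeval p P = a := by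
  have := isIntegrallyClosed_of_closed_under_division D hD
  have hX : IsIntegral D (X : k[X]) := isIntegral_of_natDegree_pos D.val (r := ⟨q, hq⟩) hq0 X
  set F : D[X] := minpoly D (X : k[X])
  have hFdvd : ∀ a : D, F.map (algebraMap D k[X]) ∣ (a : k[X]).map C - C (a : k[X]) := by
    intro a
    have h : F ∣ (a : k[X]).map (algebraMap k D) - C a := by
      apply minpoly.isIntegrallyClosed_dvd hX
      rw [map_sub, aeval_C, aeval_map_algebraMap, aeval_X_left_apply]
      exact sub_self _
    have := Polynomial.map_dvd (algebraMap D k[X]) h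
    rwa [Polynomial.map_sub, Polynomial.map_map, map_C] at this
  obtain ⟨i, hi⟩ : ∃ i, 0 < (F.coeff i : k[X]).natDegree := by
    by_contra! hcon
    let G : k[X] := ∑ i ∈ Finset.range (F.natDegree + 1), monomial i ((F.coeff i : k[X]).coeff 0)
    have hG : G.map C = F.map (algebraMap D k[X]) := by
      ext1 i
      have h1 : (F.coeff i : k[X]) = C ((F.coeff i : k[X]).coeff 0) :=
        eq_C_of_natDegree_le_zero (hcon i)
      have h2 : G.coeff i = (F.coeff i : k[X]).coeff 0 := by
        simp only [G, finsetSum_coeff, coeff_monomial]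
        rw [Finset.sum_ite_eq']
        split_ifs with h
        · rfl
        · rw [coeff_eq_zero_of_natDegree_lt (p := F) (by simpa [Nat.lt_succ_iff] using h)]; simp
      rw [coeff_map, coeff_map, h2, ← h1]; rfl
    have hroot : (G.map C).eval X = 0 := by
      rw [hG, eval_map_algebraMap, minpoly.aeval]
    rw [eval_map, eval₂_C_X] at hroot
    have hm : (F.map (algebraMap D k[X])).Monic := (minpoly.monic hX).map _
    rw [← hG, hroot, Polynomial.map_zero] at hm
    exact not_monic_zero hm
  set p : k[X] := (F.coeff i : k[X]) with hp
  have hdvd : ∀ a ∈ D, p - C (p.eval 0) ∣ a - C (a.eval 0) := by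
    intro a ha
    have h := (dvd_of_dvd_of_coeff_eq hi (hFdvd (F.coeff i)) (i := i)
      (by rw [coeff_map]; rfl)).trans (hFdvd ⟨a, ha⟩)
    have h := Polynomial.map_dvd (evalRingHom (0 : k)) h
    have hid : (evalRingHom (0 : k)).comp C = RingHom.id k := by ext; simp
    simpa [Polynomial.map_sub, Polynomial.map_map, hid] using h
  have hC : ∀ c : k, C c ∈ D := fun c => D.algebraMap_mem c
  refine ⟨p, (F.coeff i).2, hi, ?_⟩
  suffices H : ∀ n, ∀ a ∈ D, a.natDegree < n → ∃ P : k[X], aeval p P = a from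
    fun a ha => H _ a ha (Nat.lt_succ_self _)
  intro n
  induction n with
  | zero => intro a _ h; omega
  | succ n ih =>
    intro a ha han
    rcases Nat.eq_zero_or_pos a.natDegree with h0 | h0
    · refine ⟨C (a.coeff 0), ?_⟩
      rw [aeval_C, eq_C_of_natDegree_eq_zero h0]; simp
    · obtain ⟨h, hh⟩ := hdvd a ha
      have hpd : (p - C (p.eval 0)).natDegree = p.natDegree := natDegree_sub_C
      have had : (a - C (a.eval 0)).natDegree = a.natDegree := natDegree_sub_C
      have hp0 : p - C (p.eval 0) ≠ 0 := by
        intro h; rw [h] at hpd; simp at hpd; omega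
      have ha0 : a - C (a.eval 0) ≠ 0 := by
        intro h; rw [h] at had; simp at had; omega
      have hh0 : h ≠ 0 := by rintro rfl; simp at hh; exact ha0 (by simpa using hh)
      have hhD : h ∈ D := hD _ h (D.sub_mem (F.coeff i).2 (hC _)) hp0
        (hh ▸ D.sub_mem ha (hC _))
      have hdeg : h.natDegree < n := by
        have := natDegree_mul hp0 hh0
        rw [← hh, had, hpd] at this
        omega
      obtain ⟨P, hP⟩ := ih h hhD hdeg
      refine ⟨(X - C (p.eval 0)) * P + C (a.eval 0), ?_⟩
      simp only [map_add, map_mul, map_sub, aeval_X, aeval_C, hP]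
      change (p - C _) * h + C _ = a
      rw [← hh]; ring

open Polynomial in
/-- A domain embedded in `k[X]` nontrivially embeds birationally in `k[X]`. -/
theorem exists_birational_embedding {k A : Type*} [Field k] [CommRing A] [IsDomain A]
    [Algebra k A] (ψ : A →ₐ[k] k[X]) (hψ : Function.Injective ψ) {a₀ : A}
    (ha₀ : 0 < (ψ a₀).natDegree) :
    ∃ j : A →ₐ[k] k[X], Function.Injective j ∧ (∃ a, 0 < (j a).natDegree) ∧
      ∀ s, ∃ a b, a ≠ 0 ∧ j a * s = j b := by
  let D : Subalgebra k k[X] :=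
    { carrier := {f | ∃ a b, a ≠ 0 ∧ ψ a * f = ψ b}
      mul_mem' := by
        rintro f g ⟨a, b, ha, hab⟩ ⟨c, d, hc, hcd⟩
        exact ⟨a * c, b * d, mul_ne_zero ha hc, by rw [map_mul, map_mul, ← hab, ← hcd]; ring⟩
      add_mem' := by
        rintro f g ⟨a, b, ha, hab⟩ ⟨c, d, hc, hcd⟩
        refine ⟨a * c, c * b + a * d, mul_ne_zero ha hc, ?_⟩
        rw [map_add, map_mul, map_mul, map_mul, ← hab, ← hcd]; ring
      algebraMap_mem' := fun r => ⟨1, algebraMap k A r, one_ne_zero, by simp⟩ }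
  have hAD : ∀ a, ψ a ∈ D := fun a => ⟨1, a, one_ne_zero, by simp⟩
  have hD : ∀ f g, f ∈ D → f ≠ 0 → f * g ∈ D → g ∈ D := by
    rintro f g ⟨a, b, ha, hab⟩ hf ⟨c, d, hc, hcd⟩
    have hψ0 : ∀ x, x ≠ 0 → ψ x ≠ 0 := fun x hx => (map_ne_zero_iff ψ hψ).mpr hx
    refine ⟨c * b, a * d, mul_ne_zero hc ?_, ?_⟩
    · rintro rfl
      rw [map_zero] at hab
      exact mul_ne_zero (hψ0 a ha) hf hab
    · rw [map_mul, map_mul, ← hab, ← hcd]; ring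
  obtain ⟨p, hpD, hp, hgen⟩ := exists_generator_of_closed_under_division D hD (hAD a₀) ha₀
  choose L hL using fun a => hgen (ψ a) (hAD a)
  have hinj : Function.Injective (aeval p : k[X] →ₐ[k] k[X]) := by
    rw [injective_iff_map_eq_zero]
    intro P hP
    rw [← comp_eq_aeval, comp_eq_zero_iff] at hP
    rcases hP with h | ⟨-, h⟩
    · exact h
    · rw [h, natDegree_C] at hp
      exact absurd hp (lt_irrefl 0)
  let j : A →ₐ[k] k[X] :=
    { toFun := L
      map_one' := hinj (by rw [hL, map_one, map_one])
      map_mul' := fun x y => hinj (by rw [map_mul, hL, hL, hL, map_mul])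
      map_zero' := hinj (by rw [hL, map_zero, map_zero])
      map_add' := fun x y => hinj (by rw [map_add, hL, hL, hL, map_add])
      commutes' := fun r => hinj (by rw [hL, AlgHom.commutes, AlgHom.commutes]) }
  have hj : ∀ a, aeval p (j a) = ψ a := hL
  refine ⟨j, fun x y hxy => hψ (by rw [← hj, ← hj, hxy]), ⟨a₀, ?_⟩, fun s => ?_⟩
  · by_contra! h
    have h2 := hj a₀
    rw [eq_C_of_natDegree_le_zero h, aeval_C] at h2
    rw [← h2] at ha₀
    simp at ha₀
  · have hs : aeval p s ∈ D := by
      rw [show p = D.val ⟨p, hpD⟩ from rfl, aeval_algHom_apply]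
      exact Subtype.property _
    obtain ⟨a, b, ha, hab⟩ := hs
    exact ⟨a, b, ha, hinj (by rw [map_mul, hj, hj, hab])⟩

open Polynomial in
/-- The conductor of a proper birational extension `A ⊂ k[X]` is a nontrivial principal ideal
of `k[X]`. -/
theorem exists_conductor_generator {k A : Type*} [Field k] [CommRing A] [IsDomain A]
    [Algebra k A] (j : A →ₐ[k] k[X]) (hj : Function.Injective j)
    (ha : ∃ a, 0 < (j a).natDegree) (hfrac : ∀ s, ∃ a b, a ≠ 0 ∧ j a * s = j b)
    (hsurj : ¬ Function.Surjective j) :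
    ∃ f : A, 0 < (j f).natDegree ∧ (∀ s, ∃ r, j r = j f * s) ∧
      ∀ g, (∀ s, ∃ r, j r = g * s) → j f ∣ g := by
  have hcommon : ∃ d, d ≠ 0 ∧ ∀ s, ∃ r, j r = j d * s := by
    obtain ⟨a, ha⟩ := ha
    have hint := isIntegral_of_natDegree_pos j ha
    algebraize [j.toRingHom]
    have : IsScalarTower k A k[X] := .of_algHom j
    have : Algebra.FiniteType A k[X] := .of_restrictScalars_finiteType k A k[X]
    have : Module.Finite A k[X] := Algebra.IsIntegral.finite
    obtain ⟨S, hS⟩ := this.fg_top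
    have hfin : ∀ T : Finset k[X], ∃ d, d ≠ 0 ∧ ∀ s ∈ T, ∃ r, j r = j d * s := by
      classical
      intro T
      induction T using Finset.induction_on with
      | empty => exact ⟨1, one_ne_zero, by simp⟩
      | insert t T _ ih =>
        obtain ⟨d, hd, hdT⟩ := ih
        obtain ⟨a, b, ha, hab⟩ := hfrac t
        refine ⟨a * d, mul_ne_zero ha hd, fun s hs => ?_⟩
        rcases Finset.mem_insert.mp hs with rfl | hs
        · exact ⟨d * b, by rw [map_mul, map_mul, ← hab]; ring⟩
        · obtain ⟨r, hr⟩ := hdT s hs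
          exact ⟨a * r, by rw [map_mul, map_mul, hr]; ring⟩
    obtain ⟨d, hd, hdS⟩ := hfin S
    refine ⟨d, hd, fun s => ?_⟩
    have hs : s ∈ Submodule.span A (S : Set k[X]) := hS ▸ Submodule.mem_top
    induction hs using Submodule.span_induction with
    | mem x hx => exact hdS x hx
    | zero => exact ⟨0, by simp⟩
    | add x y _ _ hx hy =>
      obtain ⟨r, hr⟩ := hx
      obtain ⟨t, ht⟩ := hy
      exact ⟨r + t, by rw [map_add, hr, ht]; ring⟩
    | smul a x _ hx =>
      obtain ⟨r, hr⟩ := hx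
      refine ⟨a * r, ?_⟩
      rw [map_mul, hr, Algebra.smul_def]
      change _ = j d * (j a * x)
      ring
  let I : Ideal k[X] :=
    { carrier := {g | ∀ s, ∃ r, j r = g * s}
      add_mem' := by
        intro g h hg hh s
        obtain ⟨r, hr⟩ := hg s
        obtain ⟨t, ht⟩ := hh s
        exact ⟨r + t, by rw [map_add, hr, ht]; ring⟩
      zero_mem' := fun s => ⟨0, by simp⟩
      smul_mem' := by
        intro c g hg s
        obtain ⟨r, hr⟩ := hg (c * s)
        exact ⟨r, by rw [hr, smul_eq_mul]; ring⟩ }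
  obtain ⟨g, hg⟩ := (IsPrincipalIdealRing.principal I).principal
  have hgI : g ∈ I := by rw [hg]; exact Submodule.mem_span_singleton_self g
  have hdvd : ∀ h ∈ I, g ∣ h := fun h hh => by
    rw [hg] at hh; exact Ideal.mem_span_singleton.mp hh
  obtain ⟨f, hf⟩ := hgI 1
  rw [mul_one] at hf
  subst hf
  refine ⟨f, ?_, hgI, hdvd⟩
  by_contra! hdeg
  obtain ⟨d, hd, hds⟩ := hcommon
  have hf0 : j f ≠ 0 := by
    intro h
    have := hdvd (j d) hds
    rw [h, zero_dvd_iff, map_eq_zero_iff j hj] at this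
    exact hd this
  have hC := eq_C_of_natDegree_le_zero hdeg
  have hu : IsUnit (j f) := by
    rw [hC] at hf0 ⊢
    exact (IsUnit.mk0 _ (by simpa using hf0)).map C
  apply hsurj
  intro s
  obtain ⟨u, hu⟩ := hu
  obtain ⟨r, hr⟩ := hgI (↑u⁻¹ * s)
  exact ⟨r, by rw [hr, ← hu, Units.mul_inv_cancel_left]⟩

/-- `b` almost divides `a` if the fraction `a / b` is almost integral. -/
def AlmostDvd {R : Type*} [CommRing R] (b a : R) : Prop :=
  ∃ d ≠ 0, ∀ m : ℕ, b ^ m ∣ d * a ^ m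

theorem AlmostDvd.map {R S : Type*} [CommRing R] [CommRing S] {f : R →+* S}
    (hf : Function.Injective f) {a b : R} (h : AlmostDvd b a) : AlmostDvd (f b) (f a) := by
  obtain ⟨d, hd, h⟩ := h
  refine ⟨f d, (map_ne_zero_iff f hf).mpr hd, fun m => ?_⟩
  simpa using map_dvd f (h m)

theorem AlmostDvd.dvd {R : Type*} [CommRing R] [IsDomain R] [UniqueFactorizationMonoid R]
    {a b : R} (hb : b ≠ 0) (h : AlmostDvd b a) : b ∣ a := by
  obtain ⟨d, hd, h⟩ := h
  obtain ⟨a', b', c, hrel, ha, hb'⟩ :=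
    UniqueFactorizationMonoid.exists_reduced_factors' a b hb
  subst ha hb'
  have hc : c ≠ 0 := left_ne_zero_of_mul hb
  suffices hu : IsUnit b' from mul_dvd_mul_left c (hu.dvd)
  by_contra hu
  obtain ⟨n, hn⟩ := FiniteMultiplicity.of_not_isUnit hu hd
  apply hn
  have h1 := h (n + 1)
  rw [mul_pow, mul_pow, mul_left_comm] at h1
  have h2 := (mul_dvd_mul_iff_left (pow_ne_zero _ hc)).mp h1
  exact (hrel.symm.pow_left.pow_right).dvd_of_dvd_mul_right h2

open MvPolynomial in
/-- The extended conductor of `A ⊂ k[X]` is preserved by every ring automorphism of a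
polynomial ring over `A`. -/
theorem exists_semiinvariant {k A σ : Type*} [Field k] [CommRing A] [IsDomain A]
    [Algebra k A] (j : A →ₐ[k] Polynomial k) (hj : Function.Injective j)
    {f : A} (hf0 : f ≠ 0) (hf : ∀ s, ∃ r, j r = j f * s)
    (hmin : ∀ g, (∀ s, ∃ r, j r = g * s) → j f ∣ g)
    (τ : MvPolynomial σ A ≃+* MvPolynomial σ A) :
    ∃ c : k, τ (C f) = C (algebraMap k A c * f) := by
  let J : MvPolynomial σ A →+* MvPolynomial σ (Polynomial k) := map j.toRingHom
  have hJ : Function.Injective J := map_injective _ hj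
  have hJC : ∀ a, J (C a) = C (j a) := fun a => map_C _ _
  have hmul : ∀ s, ∃ r, J r = J (C f) * s := by
    intro s
    rw [hJC]
    induction s using MvPolynomial.induction_on' with
    | add p q hp hq =>
      obtain ⟨r, hr⟩ := hp
      obtain ⟨t, ht⟩ := hq
      exact ⟨r + t, by rw [map_add, hr, ht]; ring⟩
    | monomial u a =>
      obtain ⟨r, hr⟩ := hf a
      refine ⟨monomial u r, ?_⟩
      rw [C_mul_monomial, ← hr]
      exact map_monomial _ _ _
  have hCf : C f ≠ (0 : MvPolynomial σ A) := by simpa using hf0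
  have hdvd : ∀ a b : MvPolynomial σ A, b ≠ 0 → (AlmostDvd b a ↔ J b ∣ J a) := by
    intro a b hb
    refine ⟨fun h => (h.map hJ).dvd ((map_ne_zero_iff J hJ).mpr hb), ?_⟩
    rintro ⟨s, hs⟩
    refine ⟨C f, hCf, fun m => ?_⟩
    obtain ⟨r, hr⟩ := hmul (s ^ m)
    refine ⟨r, hJ ?_⟩
    rw [map_mul, map_mul, map_pow, map_pow, hr, hs]
    ring
  let P : MvPolynomial σ A → Prop := fun r => ∀ a b, b ≠ 0 → AlmostDvd b a → b ∣ r * a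
  have hPf : P (C f) := by
    intro a b hb hab
    obtain ⟨s, hs⟩ := (hdvd a b hb).mp hab
    obtain ⟨t, ht⟩ := hmul s
    refine ⟨t, hJ ?_⟩
    rw [map_mul, map_mul, hs, ht]
    ring
  have hPdvd : ∀ r, P r → AlmostDvd (C f) r := by
    intro r hr
    rw [hdvd _ _ hCf, hJC, C_dvd_iff_dvd_coeff]
    intro u
    apply hmin
    intro s
    obtain ⟨a, ha⟩ := hmul (C s)
    obtain ⟨t, ht⟩ := hr a (C f) hCf ((hdvd _ _ hCf).mpr ⟨_, ha⟩)
    have : J r * C s = J t := by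
      apply mul_left_cancel₀ ((map_ne_zero_iff J hJ).mpr hCf)
      rw [← map_mul, ← ht, map_mul, ha]
      ring
    refine ⟨coeff u t, ?_⟩
    have h := congrArg (coeff u) this
    rw [mul_comm, coeff_C_mul] at h
    rw [mul_comm, h]
    exact (coeff_map _ _ _).symm
  have hmap : ∀ (τ : MvPolynomial σ A ≃+* MvPolynomial σ A) {a b}, AlmostDvd b a →
      AlmostDvd (τ b) (τ a) := fun τ _ _ h => h.map (f := τ.toRingHom) τ.injective
  have hPmap : ∀ (τ : MvPolynomial σ A ≃+* MvPolynomial σ A) {r}, P r → P (τ r) := by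
    intro τ r hr a b hb hab
    have h := hr (τ.symm a) (τ.symm b) (by simpa using hb) (hmap τ.symm hab)
    have := map_dvd τ h
    simpa using this
  have h1 : J (C f) ∣ J (τ (C f)) := (hdvd _ _ hCf).mp (hPdvd _ (hPmap τ hPf))
  have h2 : J (τ (C f)) ∣ J (C f) := by
    apply (hdvd _ _ (by simpa using hf0)).mp
    have := hmap τ (hPdvd _ (hPmap τ.symm hPf))
    rwa [τ.apply_symm_apply] at this
  obtain ⟨u, hu⟩ := associated_of_dvd_dvd h1 h2
  obtain ⟨r, hr, hr'⟩ := isUnit_iff_eq_C_of_isReduced.mp u.isUnit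
  obtain ⟨c, -, rfl⟩ := Polynomial.isUnit_iff.mp hr
  refine ⟨c, hJ ?_⟩
  rw [← hu, hr', hJC, hJC, map_mul j, j.commutes, mul_comm, ← C_mul]
  rfl

open MvPolynomial in
/-- A polynomial that is semi-invariant under all automorphisms is constant. -/
theorem exists_eq_C_of_semiinvariant {k B σ : Type*} [Field k] [Infinite k] [CommRing B]
    [IsDomain B] [Algebra k B] (g : MvPolynomial σ B)
    (hg : ∀ τ : MvPolynomial σ B ≃ₐ[k] MvPolynomial σ B, ∃ c : k, τ g = c • g) :
    ∃ b, g = C b := by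
  have hinj : Function.Injective (algebraMap k B) := (algebraMap k B).injective
  have : Infinite B := Infinite.of_injective _ hinj
  have heval : ∀ (T : MvPolynomial σ B →ₐ[B] B), T g = eval (fun i => T (X i)) g := fun T =>
    congrArg (fun φ => φ g) (aeval_unique T)
  have hsmul : ∀ (γ : σ → B) (c : k), eval γ (c • g) = algebraMap k B c * eval γ g := by
    intro γ c
    rw [← IsScalarTower.algebraMap_smul B c g, smul_eval]
  have htrans : ∀ β : σ → B, ∃ c : k, eval β g = algebraMap k B c * eval 0 g := by
    intro β
    let τ : MvPolynomial σ B ≃ₐ[B] MvPolynomial σ B :=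
      AlgEquiv.ofAlgHom (aeval fun i => X i + C (β i)) (aeval fun i => X i - C (β i))
        (by ext i; simp [algebraMap_eq]) (by ext i; simp [algebraMap_eq])
    obtain ⟨c, hc⟩ := hg (τ.restrictScalars k)
    refine ⟨c, ?_⟩
    have h := congrArg (eval (0 : σ → B)) hc
    rw [hsmul] at h
    have h2 := heval ((aeval (0 : σ → B)).comp τ.toAlgHom)
    have h3 : ∀ i, (aeval (0 : σ → B)).comp τ.toAlgHom (X i) = β i := by intro i; simp [τ]
    simp only [h3] at h2
    rw [← h2, ← h]
    rfl
  by_cases h0 : eval 0 g = 0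
  · refine ⟨0, MvPolynomial.funext fun β => ?_⟩
    obtain ⟨c, hc⟩ := htrans β
    rw [hc, h0]; simp
  refine ⟨eval 0 g, MvPolynomial.funext fun β => ?_⟩
  have hX : ∀ a b : B, a * b = 1 → ∀ i : σ,
      aeval (fun i : σ => C a * X i) (C b * X i) = (X i : MvPolynomial σ B) := by
    intro a b hab i
    rw [map_mul, aeval_X, ← algebraMap_eq, AlgHom.commutes, algebraMap_eq, ← mul_assoc, ← C_mul,
      mul_comm b, hab, C_1, one_mul]
  have hscale : ∀ μ : k, μ ≠ 0 → eval (fun i => algebraMap k B μ * β i) g = eval β g := by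
    intro μ hμ
    have hμ1 : algebraMap k B μ * algebraMap k B μ⁻¹ = 1 := by
      rw [← map_mul, mul_inv_cancel₀ hμ, map_one]
    let τ : MvPolynomial σ B ≃ₐ[B] MvPolynomial σ B :=
      AlgEquiv.ofAlgHom (aeval fun i => C (algebraMap k B μ) * X i)
        (aeval fun i => C (algebraMap k B μ⁻¹) * X i)
        (algHom_ext fun i => by
          rw [AlgHom.comp_apply, aeval_X]; exact hX _ _ hμ1 i)
        (algHom_ext fun i => by
          rw [AlgHom.comp_apply, aeval_X]; exact hX _ _ ((mul_comm _ _).trans hμ1) i)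
    obtain ⟨c, hc⟩ := hg (τ.restrictScalars k)
    have hev : ∀ γ : σ → B, eval (fun i => algebraMap k B μ * γ i) g =
        algebraMap k B c * eval γ g := by
      intro γ
      have h2 := heval ((aeval γ).comp τ.toAlgHom)
      have h3 : ∀ i, (aeval γ).comp τ.toAlgHom (X i) = algebraMap k B μ * γ i := by
        intro i; simp [τ]
      simp only [h3] at h2
      rw [← h2, ← hsmul, ← hc]
      rfl
    have hc1 : algebraMap k B c = 1 := by
      have := hev 0
      simp only [Pi.zero_apply, mul_zero] at this
      exact (mul_eq_right₀ h0).mp this.symm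
    rw [hev, hc1, one_mul]
  let h : Polynomial B := aeval (fun i => Polynomial.C (β i) * Polynomial.X) g
  have hh : ∀ t : B, h.eval t = eval (fun i => t * β i) g := by
    intro t
    have h2 := heval ((Polynomial.aeval t).comp
      (aeval fun i => Polynomial.C (β i) * Polynomial.X))
    have h3 : ∀ i, (Polynomial.aeval t).comp
        (aeval fun i => Polynomial.C (β i) * Polynomial.X : MvPolynomial σ B →ₐ[B] _) (X i) =
          t * β i := by
      intro i
      rw [AlgHom.comp_apply, aeval_X, map_mul, Polynomial.aeval_C, Polynomial.aeval_X, mul_comm]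
      rfl
    simp only [h3] at h2
    exact h2
  have hconst : h = Polynomial.C (eval β g) := by
    apply Polynomial.eq_of_infinite_eval_eq
    refine Set.Infinite.mono (s := algebraMap k B '' {0}ᶜ) ?_ ?_
    · rintro _ ⟨μ, hμ, rfl⟩
      rw [Set.mem_ofPred_eq, hh, hscale μ hμ, Polynomial.eval_C]
    · exact (Set.Finite.infinite_compl (Set.finite_singleton 0)).image hinj.injOn
  have := hh 0
  rw [hconst, Polynomial.eval_C] at this
  rw [this, eval_C]
  simp only [zero_mul]
  rfl

open MvPolynomial in
/-- An infinite domain is algebraically closed in its polynomial rings. -/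
theorem exists_eq_C_of_isRoot {B σ : Type*} [CommRing B] [IsDomain B] [Infinite B]
    (x : MvPolynomial σ B) {P : Polynomial B} (hP : P ≠ 0) (hx : Polynomial.aeval x P = 0) :
    ∃ b, x = C b := by
  have hprod : (P.roots.map fun r => x - C r).prod = 0 := by
    apply MvPolynomial.funext
    intro β
    rw [map_multiset_prod, map_zero, Multiset.prod_eq_zero_iff, Multiset.map_map]
    have hr : eval β x ∈ P.roots := by
      rw [Polynomial.mem_roots hP, Polynomial.IsRoot]
      have h := congrArg (aeval β : MvPolynomial σ B →ₐ[B] B) hx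
      rw [← Polynomial.aeval_algHom_apply, map_zero] at h
      simpa [Polynomial.aeval_def, aeval_eq_eval] using h
    exact Multiset.mem_map.mpr ⟨_, hr, by simp⟩
  rw [Multiset.prod_eq_zero_iff] at hprod
  obtain ⟨r, -, hr⟩ := Multiset.mem_map.mp hprod
  exact ⟨r, sub_eq_zero.mp hr⟩

/-- The weak Nullstellensatz for quotients by maximal ideals. -/
theorem algebraMap_quotient_bijective {k B : Type*} [Field k] [IsAlgClosed k] [CommRing B]
    [Algebra k B] [Algebra.FiniteType k B] (m : Ideal B) [m.IsMaximal] :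
    Function.Bijective (algebraMap k (B ⧸ m)) := by
  let _ : Field (B ⧸ m) := Ideal.Quotient.field m
  have : Module.Finite k (B ⧸ m) := finite_of_finite_type_of_isJacobsonRing k (B ⧸ m)
  exact IsAlgClosed.algebraMap_bijective_of_isIntegral

/-- A nonzero regular function on an affine variety is nonzero at some rational point. -/
theorem exists_algHom_ne_zero {k B : Type*} [Field k] [IsAlgClosed k] [CommRing B] [IsDomain B]
    [Algebra k B] [Algebra.FiniteType k B] {b : B} (hb : b ≠ 0) :
    ∃ y : B →ₐ[k] k, y b ≠ 0 := by
  have : IsJacobsonRing B := isJacobsonRing_of_finiteType (A := k)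
  have hbot : (⊥ : Ideal B).jacobson = ⊥ :=
    this.out Ideal.isPrime_bot.isRadical
  have hb' : b ∉ (⊥ : Ideal B).jacobson := by rw [hbot]; exact hb
  rw [Ideal.jacobson, Submodule.mem_sInf] at hb'
  push Not at hb'
  obtain ⟨m, ⟨-, hm⟩, hbm⟩ := hb'
  let e : k ≃ₐ[k] B ⧸ m :=
    AlgEquiv.ofBijective (Algebra.ofId k (B ⧸ m)) (algebraMap_quotient_bijective m)
  refine ⟨e.symm.toAlgHom.comp (Ideal.Quotient.mkₐ k m), ?_⟩
  intro h
  apply hbm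
  rw [← Ideal.Quotient.eq_zero_iff_mem]
  exact (map_eq_zero_iff e.symm e.symm.injective).mp h

open MvPolynomial in
/-- A nonconstant polynomial over an affine domain is nonconstant on some line over a
rational point. -/
theorem exists_algHom_natDegree_pos {k B σ : Type*} [Field k] [IsAlgClosed k] [CommRing B]
    [IsDomain B] [Algebra k B] [Algebra.FiniteType k B] (g : MvPolynomial σ B)
    (hg : ¬ ∃ b, g = C b) :
    ∃ χ : MvPolynomial σ B →ₐ[k] Polynomial k, 0 < (χ g).natDegree := by
  classical
  have : Infinite k := IsAlgClosed.instInfinite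
  obtain ⟨m, hm0, hm⟩ : ∃ m, m ≠ 0 ∧ coeff m g ≠ 0 := by
    by_contra! hcon
    refine hg ⟨coeff 0 g, ?_⟩
    ext m
    rw [coeff_C]
    split_ifs with h
    · rw [h]
    · exact hcon m (Ne.symm h)
  obtain ⟨y, hy⟩ := exists_algHom_ne_zero (k := k) hm
  have hline : ∃ l : σ → k, eval l (map y.toRingHom g) ≠ eval 0 (map y.toRingHom g) := by
    by_contra! hcon
    have : map y.toRingHom g = C (eval 0 (map y.toRingHom g)) :=
      MvPolynomial.funext fun l => by rw [hcon l, eval_C]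
    have h := congrArg (coeff m) this
    rw [coeff_C, if_neg (Ne.symm hm0), coeff_map] at h
    exact hy h
  obtain ⟨l, hl⟩ := hline
  let χ : MvPolynomial σ B →ₐ[k] Polynomial k :=
    (aeval fun i => Polynomial.C (l i) * Polynomial.X).comp (mapAlgHom y)
  have hχ : ∀ t : k, (χ g).eval t = eval (fun i => t * l i) (map y.toRingHom g) := by
    intro t
    let T : MvPolynomial σ k →ₐ[k] k :=
      (Polynomial.aeval t).comp (aeval fun i => Polynomial.C (l i) * Polynomial.X)
    have h2 : T (map y.toRingHom g) = eval (fun i => T (X i)) (map y.toRingHom g) :=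
      congrArg (fun φ => φ (map y.toRingHom g)) (aeval_unique T)
    have h3 : ∀ i, T (X i) = t * l i := by
      intro i
      simp only [T]
      rw [AlgHom.comp_apply, aeval_X, map_mul, Polynomial.aeval_C, Polynomial.aeval_X, mul_comm]
      rfl
    simp only [h3] at h2
    exact h2
  refine ⟨χ, ?_⟩
  by_contra! hdeg
  have hc := Polynomial.eq_C_of_natDegree_le_zero hdeg
  have h1 := hχ 1
  have h0 := hχ 0
  rw [hc, Polynomial.eval_C] at h1 h0
  apply hl
  rw [h1] at h0
  simp only [one_mul, zero_mul] at h0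
  exact h0

/-- A homomorphism with a nonconstant value from an affine domain of dimension at most one to
`k[X]` is injective. -/
theorem injective_of_natDegree_pos {k A : Type*} [Field k] [IsAlgClosed k] [CommRing A]
    [IsDomain A] [Algebra k A] [Algebra.FiniteType k A] (hdim : ringKrullDim A ≤ 1)
    (ψ : A →ₐ[k] Polynomial k) {a : A} (ha : 0 < (ψ a).natDegree) : Function.Injective ψ := by
  have : Ring.KrullDimLE 1 A := Ring.krullDimLE_iff.mpr hdim
  rw [Ring.krullDimLE_one_iff_of_noZeroDivisors] at this
  rw [injective_iff_map_eq_zero]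
  by_contra hcon
  have hker : RingHom.ker ψ ≠ ⊥ := fun h => hcon fun x hx => by
    have : x ∈ RingHom.ker ψ := hx
    rwa [h] at this
  have hmax : (RingHom.ker ψ).IsMaximal := this _ hker (RingHom.ker_isPrime ψ)
  obtain ⟨c, hc⟩ := (algebraMap_quotient_bijective (k := k) (RingHom.ker ψ)).2
    (Ideal.Quotient.mk _ a)
  have h : algebraMap k A c - a ∈ RingHom.ker ψ := Ideal.Quotient.eq.mp hc
  rw [RingHom.mem_ker, map_sub, AlgHom.commutes, sub_eq_zero] at h
  rw [← h] at ha
  simp at ha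

open MvPolynomial in
/-- An isomorphism of polynomial rings over affine domains `A` and `B` maps `A` into `B`, if `A`
has dimension at most one and is not `k[t]`. -/
theorem map_C_mem_range_C {k A B σ : Type*} [Field k] [IsAlgClosed k]
    [CommRing A] [IsDomain A] [Algebra k A] [Algebra.FiniteType k A]
    (hdim : ringKrullDim A ≤ 1) (hA : ¬ Nonempty (A ≃ₐ[k] Polynomial k))
    [CommRing B] [IsDomain B] [Algebra k B] [Algebra.FiniteType k B]
    (e : MvPolynomial σ A ≃ₐ[k] MvPolynomial σ B) (a : A) : ∃ b, e (C a) = C b := by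
  have : Infinite k := IsAlgClosed.instInfinite
  have : Infinite B := Infinite.of_injective _ (algebraMap k B).injective
  by_contra hcon
  obtain ⟨χ, hχ⟩ := exists_algHom_natDegree_pos (k := k) _ hcon
  let ψ : A →ₐ[k] Polynomial k :=
    (χ.comp e.toAlgHom).comp (Algebra.ofId A (MvPolynomial σ A) |>.restrictScalars k)
  have hψ : 0 < (ψ a).natDegree := hχ
  obtain ⟨j, hj, hjdeg, hfrac⟩ :=
    exists_birational_embedding ψ (injective_of_natDegree_pos hdim ψ hψ) hψ
  have hsurj : ¬ Function.Surjective j := fun h => hA ⟨AlgEquiv.ofBijective j ⟨hj, h⟩⟩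
  obtain ⟨f, hfdeg, hf, hmin⟩ := exists_conductor_generator j hj hjdeg hfrac hsurj
  have hf0 : f ≠ 0 := by rintro rfl; simp at hfdeg
  obtain ⟨b, hb⟩ := exists_eq_C_of_semiinvariant (k := k) (e (C f)) fun τ => by
    obtain ⟨c, hc⟩ := exists_semiinvariant j hj hf0 hf hmin
      ((e.trans τ).trans e.symm).toRingEquiv
    refine ⟨c, e.symm.injective ?_⟩
    rw [map_smul, e.symm_apply_apply]
    refine Eq.trans hc ?_
    rw [C_mul, Algebra.smul_def]
    rfl
  let F : Polynomial k →ₐ[k] A := Polynomial.aeval f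
  let G : Polynomial k →ₐ[k] B := Polynomial.aeval b
  have hFj : (j.comp F) Polynomial.X = j f := by simp [F]
  obtain ⟨P, hP, hPa⟩ := isIntegral_of_natDegree_pos (j.comp F) (r := Polynomial.X)
    (by rw [hFj]; exact hfdeg) (j a)
  have hPa' : P.eval₂ F.toRingHom a = 0 := by
    apply hj
    rw [map_zero, ← hPa]
    exact Polynomial.hom_eval₂ P F.toRingHom j.toRingHom a
  refine hcon (exists_eq_C_of_isRoot _ (hP.map G.toRingHom).ne_zero ?_)
  let E : A →ₐ[k] MvPolynomial σ B :=
    e.toAlgHom.comp (Algebra.ofId A (MvPolynomial σ A) |>.restrictScalars k)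
  have hEF : E.comp F = (Algebra.ofId B (MvPolynomial σ B) |>.restrictScalars k).comp G := by
    apply Polynomial.algHom_ext
    simp only [AlgHom.comp_apply, F, G, Polynomial.aeval_X]
    exact hb
  have h := congrArg E hPa'
  rw [map_zero] at h
  rw [← h, Polynomial.aeval_def, Polynomial.eval₂_map]
  refine Eq.trans ?_ (Polynomial.hom_eval₂ P F.toRingHom E.toRingHom a).symm
  congr 1
  exact (congrArg AlgHom.toRingHom hEF).symm

open MvPolynomial in
/-- An isomorphism of polynomial rings that maps `A` into `B` maps `A` onto `B`. -/
theorem exists_map_C_eq_C {A B : Type u} {n : ℕ} [CommRing A] [IsDomain A] [Infinite A]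
    [CommRing B] [IsDomain B]
    (e : MvPolynomial (Fin n) A ≃+* MvPolynomial (Fin n) B) (he : ∀ a, ∃ b, e (C a) = C b)
    (b : B) : ∃ a, e (C a) = C b := by
  choose i hi using he
  have hCinj := C_injective (Fin n) B
  let ι : A →+* B :=
    { toFun := i
      map_one' := hCinj (by rw [← hi, C_1, map_one, C_1])
      map_mul' := fun x y => hCinj (by rw [← hi, C_mul, C_mul, map_mul, hi, hi])
      map_zero' := hCinj (by rw [← hi, C_0, map_zero, C_0])
      map_add' := fun x y => hCinj (by rw [← hi, C_add, C_add, map_add, hi, hi]) }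
  have hι : ∀ a, e (C a) = C (ι a) := hi
  have hιinj : Function.Injective ι := fun x y h =>
    C_injective (Fin n) A (e.injective (by rw [hι, hι, h]))
  algebraize [ι]
  have : FaithfulSMul A B := (faithfulSMul_iff_algebraMap_injective A B).mpr hιinj
  let E : MvPolynomial (Fin n) A ≃ₐ[A] MvPolynomial (Fin n) B := AlgEquiv.ofRingEquiv (f := e) hι
  have htr := trdeg_add_eq A B (A := MvPolynomial (Fin n) B)
  rw [← E.trdeg_eq, trdeg_of_isDomain, trdeg_of_isDomain] at htr
  have hzero : Algebra.trdeg A B = 0 := by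
    refine Cardinal.eq_of_add_eq_add_right (htr.trans (zero_add _).symm) ?_
    simp
  have halg : Algebra.IsAlgebraic A B := trdeg_eq_zero_iff.mp hzero
  obtain ⟨P, hP, hPb⟩ := halg.isAlgebraic b
  obtain ⟨a, ha⟩ := exists_eq_C_of_isRoot (E.symm (C b)) hP (by
    have : C b = algebraMap B (MvPolynomial (Fin n) B) b := rfl
    rw [Polynomial.aeval_algEquiv, AlgHom.comp_apply, this, Polynomial.aeval_algebraMap_apply, hPb]
    simp)
  refine ⟨a, ?_⟩
  rw [← ha]
  exact E.apply_symm_apply _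

open MvPolynomial in
/-- Strong retractability of `A` with respect to commutative algebras `B`. -/
theorem includeLeft_range_map_eq (k : Type u) [Field k] [IsAlgClosed k]
    (A : Type u) [CommRing A] [IsDomain A] [Algebra k A] [Algebra.FiniteType k A]
    (hdim : ringKrullDim A ≤ 1) (hA : ¬ Nonempty (A ≃ₐ[k] Polynomial k)) (n : ℕ)
    (B : Type u) [CommRing B] [Algebra k B]
    (φ : (A ⊗[k] MvPolynomial (Fin n) k) ≃ₐ[k] (B ⊗[k] MvPolynomial (Fin n) k)) :
    Subalgebra.map φ.toAlgHom
        (Algebra.TensorProduct.includeLeft (R := k) (S := k) (A := A)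
          (B := MvPolynomial (Fin n) k)).range =
      (Algebra.TensorProduct.includeLeft (R := k) (S := k) (A := B)
        (B := MvPolynomial (Fin n) k)).range := by
  let eA := (algebraTensorAlgEquiv k (σ := Fin n) A)
  let eB := (algebraTensorAlgEquiv k (σ := Fin n) B)
  let e : MvPolynomial (Fin n) A ≃ₐ[k] MvPolynomial (Fin n) B :=
    ((eA.restrictScalars k).symm.trans φ).trans (eB.restrictScalars k)
  have heA : ∀ a, eA (a ⊗ₜ 1) = C a := fun a => eA.commutes a
  have heB : ∀ b, eB (b ⊗ₜ 1) = C b := fun b => eB.commutes b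
  have he : ∀ a, e (C a) = eB (φ (a ⊗ₜ 1)) := by
    intro a
    rw [← heA]
    simp [e]
  have : IsDomain (MvPolynomial (Fin n) B) := e.symm.toMulEquiv.isDomain _
  have : IsDomain B := (C_injective (Fin n) B).isDomain C
  have : Infinite k := IsAlgClosed.instInfinite
  have : Infinite A := Infinite.of_injective _ (algebraMap k A).injective
  have : Algebra.FiniteType k (MvPolynomial (Fin n) A) :=
    Algebra.FiniteType.trans (S := A) inferInstance inferInstance
  have : Algebra.FiniteType k B :=
    Algebra.FiniteType.of_surjective
      (((aeval (0 : Fin n → B)).restrictScalars k).comp e.toAlgHom)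
      (fun b => ⟨e.symm (C b), by simp⟩)
  have hsub : ∀ a, ∃ b, e (C a) = C b := map_C_mem_range_C hdim hA e
  ext x
  constructor
  · rintro ⟨_, ⟨a, rfl⟩, rfl⟩
    obtain ⟨b, hb⟩ := hsub a
    refine ⟨b, eB.injective ?_⟩
    rw [he] at hb
    exact (heB b).trans hb.symm
  · rintro ⟨b, rfl⟩
    obtain ⟨a, ha⟩ := exists_map_C_eq_C e.toRingEquiv hsub b
    refine ⟨_, ⟨a, rfl⟩, eB.injective ?_⟩
    exact (he a).symm.trans (Eq.trans ha (heB b).symm)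

theorem includeLeft_mvPolynomial_injective (k B σ : Type*) [Field k] [Ring B] [Algebra k B] :
    Function.Injective (Algebra.TensorProduct.includeLeft (R := k) (S := k) (A := B)
      (B := MvPolynomial σ k)) :=
  Algebra.TensorProduct.includeLeft_injective (algebraMap k (MvPolynomial σ k)).injective

theorem stronglyRetractable_of_ringKrullDim_le_one (k : Type u) [Field k] [IsAlgClosed k]
    (A : Type u) [CommRing A] [IsDomain A] [Algebra k A] [Algebra.FiniteType k A]
    (hdim : ringKrullDim A ≤ 1)
    (hA : ¬ Nonempty (A ≃ₐ[k] Polynomial k)) : StronglyRetractable k A := by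
  intro n _ B instB _ φ
  have hcomm : ∀ x y : B, x * y = y * x := by
    intro x y
    apply includeLeft_mvPolynomial_injective k B (Fin n)
    apply φ.symm.injective
    rw [map_mul, map_mul, map_mul, map_mul, mul_comm]
  let _ : CommRing B := { instB with mul_comm := hcomm }
  exact includeLeft_range_map_eq k A hdim hA n B φ

theorem StronglyRetractable.stronglyCancellative {k : Type u} [Field k] {A : Type u} [Ring A]
    [Algebra k A] (h : StronglyRetractable k A) : StronglyCancellative k A := by
  rintro n hn B _ _ ⟨φ⟩
  have hA := AlgEquiv.ofInjective _ (includeLeft_mvPolynomial_injective k A (Fin n))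
  have hB := AlgEquiv.ofInjective _ (includeLeft_mvPolynomial_injective k B (Fin n))
  exact ⟨((hA.trans (Subalgebra.equivMapOfInjective _ φ.toAlgHom φ.injective)).trans
    (Subalgebra.equivOfEq _ _ (h n hn B φ))).trans hB.symm⟩

/-- Over an algebraically closed field `k`, a commutative affine domain of Krull
dimension at most one that is not isomorphic to `k[t]` is strongly retractable and,
consequently, strongly cancellative. -/
theorem statement9 (k : Type u) [Field k] [IsAlgClosed k]
    (A : Type u) [CommRing A] [IsDomain A] [Algebra k A] [Algebra.FiniteType k A]
    (hdim : ringKrullDim A ≤ 1)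
    (hA : ¬ Nonempty (A ≃ₐ[k] Polynomial k)) :
    StronglyRetractable k A ∧ StronglyCancellative k A :=
  have h := stronglyRetractable_of_ringKrullDim_le_one k A hdim hA
  ⟨h, h.stronglyCancellative⟩
end

section
/- Let k be an algebraically closed field, let A be a k-algebra whose center is trivial (Z(A) = k·1), and let R be a commutative k-algebra that is strongly cancellative. Then the tensor product A ⊗_k R is strongly cancellative: for every n ≥ 1 and every k-algebra B, every k-algebra isomorphism (A ⊗_k R) ⊗_k k[t_1,…,t_n] ≅ B ⊗_k k[t_1,…,t_n] implies A ⊗_k R ≅ B as k-algebras. -/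
open scoped TensorProduct

universe u

section CenterCancellation

open Algebra.TensorProduct

variable {k : Type*} [Field k]

theorem AlgHom.exists_algEquiv_of_range_eq {X Y M : Type*} [Ring X] [Ring Y] [Ring M]
    [Algebra k X] [Algebra k Y] [Algebra k M] (f : X →ₐ[k] M) (g : Y →ₐ[k] M)
    (hf : Function.Injective f) (hg : Function.Injective g) (h : f.range = g.range) :
    ∃ e : X ≃ₐ[k] Y, ∀ x, g (e x) = f x := by
  refine ⟨((AlgEquiv.ofInjective f hf).trans (Subalgebra.equivOfEq _ _ h)).trans
    (AlgEquiv.ofInjective g hg).symm, fun x => ?_⟩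
  exact congrArg Subtype.val ((AlgEquiv.ofInjective g hg).apply_symm_apply
    (Subalgebra.equivOfEq _ _ h (AlgEquiv.ofInjective f hf x)))

/-- The center of `C ⊗[k] T`, for `T` commutative, is the image of `Z(C) ⊗[k] T`. -/
theorem center_tensorProduct_eq_range (C T : Type*) [Ring C] [Algebra k C]
    [CommRing T] [Algebra k T] :
    Subalgebra.center k (C ⊗[k] T) =
      (map (Subalgebra.center k C).val (AlgHom.id k T)).range := by
  rw [← Subalgebra.centralizer_coe_range_includeLeft_eq_center_tensorProduct]
  refine le_antisymm (Subalgebra.center_le_centralizer _ _) fun z hz => ?_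
  rw [Subalgebra.mem_centralizer_iff] at hz
  rw [Subalgebra.mem_center_iff]
  intro w
  induction w with
  | zero => simp
  | add x y hx hy => rw [add_mul, mul_add, hx, hy]
  | tmul c t =>
    have hl : Commute (c ⊗ₜ[k] (1 : T)) z := hz _ ⟨c, rfl⟩
    have hr : Commute ((1 : C) ⊗ₜ[k] t) z := by
      clear hz hl
      induction z with
      | zero => exact Commute.zero_right _
      | add x y hx hy => exact hx.add_right hy
      | tmul d s => exact (Commute.one_left d).tmul (Commute.all t s)
    have := hl.mul_left hr
    simpa using this.eq

theorem center_tensorProduct_eq_range_includeRight {A : Type*} (T : Type*) [Ring A]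
    [Algebra k A] [CommRing T] [Algebra k T] (hZ : Subalgebra.center k A = ⊥) :
    Subalgebra.center k (A ⊗[k] T) = (includeRight : T →ₐ[k] A ⊗[k] T).range := by
  rw [center_tensorProduct_eq_range]
  apply le_antisymm
  · rintro _ ⟨z, rfl⟩
    change map (Subalgebra.center k A).val (AlgHom.id k T) z ∈ _
    induction z with
    | zero => rw [map_zero]; exact zero_mem _
    | add x y hx hy => rw [map_add]; exact add_mem hx hy
    | tmul a t =>
      obtain ⟨a, ha⟩ := a
      rw [hZ] at ha
      obtain ⟨c, rfl⟩ := Algebra.mem_bot.mp ha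
      refine ⟨c • t, ?_⟩
      simp [Algebra.algebraMap_eq_smul_one, TensorProduct.smul_tmul]
  · rintro _ ⟨t, rfl⟩
    exact ⟨1 ⊗ₜ t, by simp⟩

/-- Let `A` have trivial center and let `T`, `P` be commutative with an augmentation
`ε : P → k`. An isomorphism `A ⊗ T ≃ B ⊗ P` matches the centers `T` and `Z(B) ⊗ P`, and
reducing modulo the augmentation identifies `B` with `A ⊗ Z(B)`. -/
theorem exists_center_algEquiv_of_tensorProduct_algEquiv {A B T P : Type*} [Ring A] [Nontrivial A]
    [Ring B] [CommRing T] [CommRing P] [Algebra k A] [Algebra k B] [Algebra k T] [Algebra k P]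
    (hZ : Subalgebra.center k A = ⊥) (ε : P →ₐ[k] k) (ψ : A ⊗[k] T ≃ₐ[k] B ⊗[k] P) :
    Nonempty (T ≃ₐ[k] Subalgebra.center k B ⊗[k] P) ∧
      Nonempty (A ⊗[k] Subalgebra.center k B ≃ₐ[k] B) := by
  have hinj : Function.Injective (map (Subalgebra.center k B).val (AlgHom.id k P)) :=
    Module.Flat.rTensor_preserves_injective_linearMap (M := P)
      (Subalgebra.center k B).val.toLinearMap Subtype.val_injective
  have hrange : (ψ.toAlgHom.comp (includeRight : T →ₐ[k] A ⊗[k] T)).range =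
      (map (Subalgebra.center k B).val (AlgHom.id k P)).range := by
    rw [← center_tensorProduct_eq_range, AlgHom.range_comp,
      ← center_tensorProduct_eq_range_includeRight T hZ]
    ext x
    rw [Subalgebra.mem_map, Subalgebra.mem_center_iff]
    constructor
    · rintro ⟨y, hy, rfl⟩ b
      obtain ⟨c, rfl⟩ := ψ.surjective b
      rw [Subalgebra.mem_center_iff] at hy
      simpa using congrArg ψ (hy c)
    · intro hx
      refine ⟨ψ.symm x, Subalgebra.mem_center_iff.mpr fun c => ψ.injective ?_, by simp⟩
      simpa using hx (ψ c)
  obtain ⟨e, he⟩ := AlgHom.exists_algEquiv_of_range_eq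
    (ψ.toAlgHom.comp (includeRight : T →ₐ[k] A ⊗[k] T)) _
    (ψ.injective.comp (includeRight_injective (algebraMap k A).injective)) hinj hrange
  replace he : ∀ t, map (Subalgebra.center k B).val (AlgHom.id k P) (e t) = ψ (1 ⊗ₜ t) := he
  refine ⟨⟨e⟩, ?_⟩
  let evB : B ⊗[k] P →ₐ[k] B :=
    lift (AlgHom.id k B) ((Algebra.ofId k B).comp ε) fun x y => Algebra.commutes' _ _ |>.symm
  let evS : Subalgebra.center k B ⊗[k] P →ₐ[k] Subalgebra.center k B :=
    lift (AlgHom.id k _) ((Algebra.ofId k _).comp ε) fun x y => Commute.all _ _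
  have hevB : ∀ b p, evB (b ⊗ₜ p) = b * algebraMap k B (ε p) := fun _ _ => rfl
  have hev : ∀ z, (evS z : B) = evB (map (Subalgebra.center k B).val (AlgHom.id k P) z) :=
    DFunLike.congr_fun (show (Subalgebra.center k B).val.comp evS = evB.comp (map _ _) by
      ext <;> simp [evS, hevB])
  let q : A ⊗[k] T →ₐ[k] A ⊗[k] Subalgebra.center k B :=
    map (AlgHom.id k A) (evS.comp e.toAlgHom)
  let H : B ⊗[k] P →ₐ[k] A ⊗[k] Subalgebra.center k B := q.comp ψ.symm.toAlgHom
  let F : B →ₐ[k] A ⊗[k] Subalgebra.center k B := H.comp includeLeft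
  let G : A ⊗[k] Subalgebra.center k B →ₐ[k] B :=
    lift (evB.comp (ψ.toAlgHom.comp includeLeft)) (Subalgebra.center k B).val
      fun x y => Subalgebra.mem_center_iff.mp y.2 _
  have hG : ∀ a s, G (a ⊗ₜ s) = evB (ψ (a ⊗ₜ 1)) * s := fun _ _ => rfl
  have hGq : G.comp q = evB.comp ψ.toAlgHom := by
    ext x
    · simp [hG, q]
    · simp [hG, q, hev, he, ← Algebra.TensorProduct.one_def]
  have hHz : ∀ z, H (map (Subalgebra.center k B).val (AlgHom.id k P) z) = 1 ⊗ₜ evS z := by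
    intro z
    obtain ⟨t, rfl⟩ := e.surjective z
    simp [H, q, he]
  have hHF : H = F.comp evB := by
    ext x
    · simp [F, hevB]
    · have := hHz (1 ⊗ₜ x)
      simpa [F, hevB, evS, ← Algebra.TensorProduct.one_def, Algebra.ofId_apply,
        Algebra.algebraMap_eq_smul_one] using this
  refine ⟨AlgEquiv.ofAlgHom G F ?_ ?_⟩
  · ext b
    have := DFunLike.congr_fun hGq (ψ.symm (b ⊗ₜ 1))
    simpa [F, H, hevB] using this
  · ext x
    · have := DFunLike.congr_fun hHF (ψ (x ⊗ₜ 1))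
      simpa [hG, H, q] using this.symm
    · have := hHz (x ⊗ₜ 1)
      simpa [hG, F, evS, ← Algebra.TensorProduct.one_def] using this

end CenterCancellation

/-- Over an algebraically closed field `k`, if `A` is a `k`-algebra with trivial center
and `R` is a commutative `k`-algebra that is strongly cancellative, then `A ⊗[k] R` is
strongly cancellative. -/
theorem statement10 (k : Type u) [Field k] [IsAlgClosed k]
    (A : Type u) [Ring A] [Algebra k A] (hZ : Subalgebra.center k A = ⊥)
    (R : Type u) [CommRing R] [Algebra k R] (hR : StronglyCancellative k R) :
    StronglyCancellative k (A ⊗[k] R) := by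
  rintro n hn B _ _ ⟨φ⟩
  let ψ : A ⊗[k] (R ⊗[k] MvPolynomial (Fin n) k) ≃ₐ[k] B ⊗[k] MvPolynomial (Fin n) k :=
    (Algebra.TensorProduct.assoc k k k A R (MvPolynomial (Fin n) k)).symm.trans φ
  cases subsingleton_or_nontrivial A
  · have hAR : Subsingleton (A ⊗[k] R) := Module.subsingleton A _
    have : Subsingleton (A ⊗[k] (R ⊗[k] MvPolynomial (Fin n) k)) := Module.subsingleton A _
    have : Subsingleton (B ⊗[k] MvPolynomial (Fin n) k) := ψ.symm.injective.subsingleton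
    have : Subsingleton B := (Algebra.TensorProduct.includeLeft_injective (S := k)
      (algebraMap k (MvPolynomial (Fin n) k)).injective).subsingleton
    exact ⟨AlgEquiv.ofAlgHom
      { toFun := 0, map_one' := Subsingleton.elim _ _, map_mul' := fun _ _ => Subsingleton.elim _ _,
        map_zero' := rfl, map_add' := fun _ _ => Subsingleton.elim _ _,
        commutes' := fun _ => Subsingleton.elim _ _ }
      { toFun := 0, map_one' := Subsingleton.elim _ _, map_mul' := fun _ _ => Subsingleton.elim _ _,
        map_zero' := rfl, map_add' := fun _ _ => Subsingleton.elim _ _,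
        commutes' := fun _ => Subsingleton.elim _ _ }
      (AlgHom.ext fun _ => Subsingleton.elim _ _) (AlgHom.ext fun _ => Subsingleton.elim _ _)⟩
  · obtain ⟨hT, ⟨g⟩⟩ :=
      exists_center_algEquiv_of_tensorProduct_algEquiv hZ (MvPolynomial.aeval 0) ψ
    obtain ⟨f⟩ := hR n hn (Subalgebra.center k B) hT
    exact ⟨(Algebra.TensorProduct.congr AlgEquiv.refl f).trans g⟩
end

section
/- Let k be an algebraically closed field and let A be a noetherian k-algebra such that: (i) there is a central element t ∈ A that is transcendental over k and generates the center, i.e., Z(A) is the k-subalgebra generated by t (so Z(A) ≅ k[t]); (ii) t lies in the two-sided ideal [A,A] of A generated by all commutators ab − ba; and (iii) [A,A] ≠ A. Then A is strongly Z-retractable and strongly cancellative. -/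
open scoped TensorProduct

universe u

/-- A `k`-algebra `A` is strongly Z-retractable if for every `n ≥ 1`, every `k`-algebra
`B` and every `k`-algebra isomorphism `φ : A ⊗[k] k[t₁,…,tₙ] ≅ B ⊗[k] k[t₁,…,tₙ]`, `φ`
maps the subalgebra `Z(A) ⊗ 1` onto the subalgebra `Z(B) ⊗ 1`. -/
def StronglyZRetractable (k : Type u) [Field k] (A : Type u) [Ring A] [Algebra k A] : Prop :=
  ∀ (n : ℕ), 1 ≤ n → ∀ (B : Type u) [Ring B] [Algebra k B]
    (φ : (A ⊗[k] MvPolynomial (Fin n) k) ≃ₐ[k] (B ⊗[k] MvPolynomial (Fin n) k)),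
    Subalgebra.map φ.toAlgHom
        (Subalgebra.map
          (Algebra.TensorProduct.includeLeft (R := k) (S := k) (A := A)
            (B := MvPolynomial (Fin n) k))
          (Subalgebra.center k A)) =
      Subalgebra.map
        (Algebra.TensorProduct.includeLeft (R := k) (S := k) (A := B)
          (B := MvPolynomial (Fin n) k))
        (Subalgebra.center k B)

/-- The two-sided ideal `[A,A]` of `A` generated by all commutators `a*b - b*a`. -/
def commutatorIdeal (A : Type u) [Ring A] : TwoSidedIdeal A :=
  TwoSidedIdeal.span {x : A | ∃ a b : A, x = a * b - b * a}

namespace MvPolynomial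

variable {σ R : Type*} [CommRing R] [IsDomain R]

theorem mem_range_C_of_dvd_C {p : MvPolynomial σ R} {r : R} (hr : r ≠ 0) (h : p ∣ C r) :
    ∃ s, p = C s := by
  have hd := totalDegree_le_of_dvd_of_isDomain h (by simpa using hr)
  rw [totalDegree_C, Nat.le_zero] at hd
  exact ⟨_, totalDegree_eq_zero_iff_eq_C.mp hd⟩

theorem mem_range_C_of_isAlgebraic {p : MvPolynomial σ R} (h : IsAlgebraic R p) :
    ∃ s, p = C s := by
  by_cases hp : p = 0
  · exact ⟨0, by simp [hp]⟩
  · obtain ⟨r, hr, hdvd⟩ := h.exists_nonzero_dvd (mem_nonZeroDivisors_of_ne_zero hp)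
    exact mem_range_C_of_dvd_C hr hdvd

variable {k : Type u} [Field k] {n : ℕ} {Z W : Type u} [CommRing Z] [CommRing W] [Algebra k Z]
  [Algebra k W]

theorem trdeg_eq_of_algEquiv [IsDomain Z] [IsDomain W]
    (e : MvPolynomial (Fin n) Z ≃ₐ[k] MvPolynomial (Fin n) W) :
    Algebra.trdeg k Z + n = Algebra.trdeg k W + n := by
  have h := e.trdeg_eq
  rw [← _root_.trdeg_add_eq k Z (A := MvPolynomial (Fin n) Z),
    ← _root_.trdeg_add_eq k W (A := MvPolynomial (Fin n) W), trdeg_of_isDomain,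
    trdeg_of_isDomain] at h
  simpa using h

theorem isAlgebraic_adjoin_of_algEquiv [IsDomain W]
    (e₀ : Polynomial k ≃ₐ[k] Z)
    (e : MvPolynomial (Fin n) Z ≃ₐ[k] MvPolynomial (Fin n) W) {s : W} (hs : Transcendental k s) :
    Algebra.IsAlgebraic (Algebra.adjoin k {s}) W := by
  have : IsDomain Z := e₀.symm.toMulEquiv.isDomain (Polynomial k)
  have hW := trdeg_eq_of_algEquiv e
  rw [← e₀.trdeg_eq, Polynomial.trdeg_of_isDomain,
    Cardinal.add_nat_inj] at hW
  have hind : AlgebraicIndependent k (fun _ : Unit => s) :=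
    (algebraicIndependent_unique_type_iff).mpr hs
  have := (hind.isTranscendenceBasis_of_lift_trdeg_le_of_finite (by simp [← hW])).isAlgebraic
  rwa [Set.range_const] at this

/-- An isomorphism of polynomial rings carries the coefficient ring `k[t]` onto the other
coefficient ring as soon as the image of `t` divides a nonzero constant. -/
theorem map_range_C_of_algEquiv [IsDomain W] (e₀ : Polynomial k ≃ₐ[k] Z)
    (e : MvPolynomial (Fin n) Z ≃ₐ[k] MvPolynomial (Fin n) W) {w : W} (hw : w ≠ 0)
    (hdvd : C (e₀ Polynomial.X) ∣ e.symm (C w)) :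
    (∀ z, ∃ w, e (C z) = C w) ∧ ∀ w, ∃ z, e (C z) = C w := by
  have : IsDomain Z := e₀.symm.toMulEquiv.isDomain (Polynomial k)
  obtain ⟨s, hs⟩ : ∃ s, e (C (e₀ Polynomial.X)) = C s := by
    refine mem_range_C_of_dvd_C hw ?_
    simpa using map_dvd e hdvd
  have key : (e.toAlgHom.comp (Algebra.algHom k Z _)).comp
      e₀.toAlgHom =
      (Algebra.algHom k W (MvPolynomial (Fin n) W)).comp (Polynomial.aeval s) := by
    apply Polynomial.algHom_ext
    simpa [Algebra.algHom, algebraMap_eq] using hs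
  have key' (p : Polynomial k) : e (C (e₀ p)) = C (Polynomial.aeval s p) :=
    DFunLike.congr_fun key p
  have hst : Transcendental k s := by
    rw [transcendental_iff_injective]
    intro p q hpq
    have : e (C (e₀ p)) = e (C (e₀ q)) := by rw [key', key', hpq]
    simpa using this
  have halg := isAlgebraic_adjoin_of_algEquiv e₀ e hst
  refine ⟨fun z => ⟨Polynomial.aeval s (e₀.symm z), by simp [← key']⟩, fun w => ?_⟩
  suffices ∃ z, e.symm (C w) = C z by
    obtain ⟨z, hz⟩ := this
    exact ⟨z, by simp [← hz]⟩
  apply mem_range_C_of_isAlgebraic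
  obtain ⟨q, hq, hqw⟩ := halg.isAlgebraic w
  let f : Algebra.adjoin k {s} →+* Z :=
    (e₀.toAlgHom.comp (AlgEquiv.ofInjective (Polynomial.aeval s)
      (transcendental_iff_injective.mp hst)).symm.toAlgHom |>.comp
      (Subalgebra.inclusion (Algebra.adjoin_singleton_eq_range_aeval k s).le)).toRingHom
  have hf : Function.Injective f := by
    intro x y hxy
    exact Subalgebra.inclusion_injective _ (by simpa [f] using hxy)
  have hfC (x : Algebra.adjoin k {s}) : C (f x) = e.symm (C (x : W)) := by
    rw [AlgEquiv.eq_symm_apply]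
    obtain ⟨p, hp⟩ : ∃ p, x = ⟨Polynomial.aeval s p, Polynomial.aeval_mem_adjoin_singleton k s⟩ := by
      obtain ⟨x, hx⟩ := x
      obtain ⟨p, rfl⟩ := (Algebra.adjoin_singleton_eq_range_aeval k s).le hx
      exact ⟨p, rfl⟩
    have : f x = e₀ p := by
      subst hp
      exact congrArg e₀ ((AlgEquiv.ofInjective (Polynomial.aeval s)
        (transcendental_iff_injective.mp hst)).symm_apply_apply p)
    rw [this, key', hp]
  refine ⟨q.map f, (Polynomial.map_ne_zero_iff hf).mpr hq, ?_⟩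
  have h2 : ((e.symm.toRingEquiv.toRingHom).comp
      (C : W →+* MvPolynomial (Fin n) W)) (Polynomial.aeval w q) = 0 := by rw [hqw, map_zero]
  rw [Polynomial.aeval_def, Polynomial.hom_eval₂] at h2
  have hcomp : (algebraMap Z (MvPolynomial (Fin n) Z)).comp f =
      ((e.symm.toRingEquiv.toRingHom).comp C).comp
        (algebraMap (Algebra.adjoin k {s}) W) := RingHom.ext hfC
  rw [Polynomial.aeval_def, Polynomial.eval₂_map, hcomp]
  exact h2

end MvPolynomial

section TensorPolynomial

variable {k : Type u} [Field k] {A : Type u} [Ring A] [Algebra k A] {σ : Type*}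

/-- The `m`-th coefficient of an element of `A ⊗[k] k[σ]`. -/
noncomputable def tensorCoeff (m : σ →₀ ℕ) : A ⊗[k] MvPolynomial σ k →ₗ[k] A :=
  (TensorProduct.rid k A).toLinearMap ∘ₗ (MvPolynomial.lcoeff k m).lTensor A

@[simp]
theorem tensorCoeff_tmul (m : σ →₀ ℕ) (a : A) (p : MvPolynomial σ k) :
    tensorCoeff m (a ⊗ₜ[k] p) = p.coeff m • a := by
  simp [tensorCoeff]

theorem tensorCoeff_monomial_mul (m d : σ →₀ ℕ) (c : k) (a : A)
    (x : A ⊗[k] MvPolynomial σ k) :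
    tensorCoeff m ((a ⊗ₜ[k] MvPolynomial.monomial d c) * x) =
      if d ≤ m then (c • a) * tensorCoeff (m - d) x else 0 := by
  induction x with
  | zero => simp
  | add x y hx hy => rw [mul_add, map_add, hx, hy, map_add]; split_ifs <;> simp [mul_add]
  | tmul b q =>
    rw [Algebra.TensorProduct.tmul_mul_tmul, tensorCoeff_tmul, MvPolynomial.coeff_monomial_mul']
    split_ifs <;> simp [smul_smul, mul_comm]

theorem tensorCoeff_mul_monomial (m d : σ →₀ ℕ) (c : k) (a : A)
    (x : A ⊗[k] MvPolynomial σ k) :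
    tensorCoeff m (x * (a ⊗ₜ[k] MvPolynomial.monomial d c)) =
      if d ≤ m then tensorCoeff (m - d) x * (c • a) else 0 := by
  induction x with
  | zero => simp
  | add x y hx hy => rw [add_mul, map_add, hx, hy, map_add]; split_ifs <;> simp [add_mul]
  | tmul b q =>
    rw [Algebra.TensorProduct.tmul_mul_tmul, tensorCoeff_tmul, MvPolynomial.coeff_mul_monomial']
    split_ifs <;> simp [smul_smul, mul_comm]

theorem smul_mem_twoSidedIdeal {I : TwoSidedIdeal A} (c : k) {a : A} (ha : a ∈ I) :
    c • a ∈ I := by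
  rw [Algebra.smul_def]
  exact I.mul_mem_left _ _ ha

theorem tensorCoeff_mul_mem_left {I : TwoSidedIdeal A} (x : A ⊗[k] MvPolynomial σ k)
    {y : A ⊗[k] MvPolynomial σ k} (hy : ∀ m, tensorCoeff m y ∈ I) (m : σ →₀ ℕ) :
    tensorCoeff m (x * y) ∈ I := by
  induction x with
  | zero => simp
  | add x₁ x₂ h₁ h₂ => rw [add_mul, map_add]; exact I.add_mem h₁ h₂
  | tmul a p =>
    induction p using MvPolynomial.induction_on' with
    | monomial d c =>
      rw [tensorCoeff_monomial_mul]
      split_ifs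
      · exact I.mul_mem_left _ _ (hy _)
      · exact I.zero_mem
    | add p q hp hq => rw [TensorProduct.tmul_add, add_mul, map_add]; exact I.add_mem hp hq

theorem tensorCoeff_mul_mem_right {I : TwoSidedIdeal A} (x : A ⊗[k] MvPolynomial σ k)
    {y : A ⊗[k] MvPolynomial σ k} (hy : ∀ m, tensorCoeff m y ∈ I) (m : σ →₀ ℕ) :
    tensorCoeff m (y * x) ∈ I := by
  induction x with
  | zero => simp
  | add x₁ x₂ h₁ h₂ => rw [mul_add, map_add]; exact I.add_mem h₁ h₂
  | tmul a p =>
    induction p using MvPolynomial.induction_on' with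
    | monomial d c =>
      rw [tensorCoeff_mul_monomial]
      split_ifs
      · exact I.mul_mem_right _ _ (hy _)
      · exact I.zero_mem
    | add p q hp hq => rw [TensorProduct.tmul_add, mul_add, map_add]; exact I.add_mem hp hq

theorem commutator_mem_commutatorIdeal (a b : A) : a * b - b * a ∈ commutatorIdeal A :=
  TwoSidedIdeal.subset_span ⟨a, b, rfl⟩

theorem tensorCoeff_commutator_mem (x y : A ⊗[k] MvPolynomial σ k) (m : σ →₀ ℕ) :
    tensorCoeff m (x * y - y * x) ∈ commutatorIdeal A := by
  induction x with
  | zero => simp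
  | add x₁ x₂ h₁ h₂ =>
    rw [add_mul, mul_add, add_sub_add_comm, map_add]
    exact (commutatorIdeal A).add_mem h₁ h₂
  | tmul a p =>
    induction y with
    | zero => simp
    | add y₁ y₂ h₁ h₂ =>
      rw [add_mul, mul_add, add_sub_add_comm, map_add]
      exact (commutatorIdeal A).add_mem h₁ h₂
    | tmul b q =>
      rw [Algebra.TensorProduct.tmul_mul_tmul, Algebra.TensorProduct.tmul_mul_tmul, mul_comm q p,
        ← TensorProduct.sub_tmul, tensorCoeff_tmul]
      exact smul_mem_twoSidedIdeal _ (commutator_mem_commutatorIdeal a b)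

theorem tensorCoeff_mem_commutatorIdeal {x : A ⊗[k] MvPolynomial σ k}
    (hx : x ∈ commutatorIdeal (A ⊗[k] MvPolynomial σ k)) (m : σ →₀ ℕ) :
    tensorCoeff m x ∈ commutatorIdeal A := by
  let I : TwoSidedIdeal (A ⊗[k] MvPolynomial σ k) := TwoSidedIdeal.mk'
    {x | ∀ m, tensorCoeff m x ∈ commutatorIdeal A}
    (fun m => by simp)
    (fun hx hy m => by rw [map_add]; exact (commutatorIdeal A).add_mem (hx m) (hy m))
    (fun hx m => by rw [map_neg]; exact (commutatorIdeal A).neg_mem (hx m))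
    (fun hy => tensorCoeff_mul_mem_left _ hy)
    (fun hx => tensorCoeff_mul_mem_right _ hx)
  have hle : commutatorIdeal (A ⊗[k] MvPolynomial σ k) ≤ I := by
    refine TwoSidedIdeal.span_le.mpr ?_
    rintro _ ⟨x, y, rfl⟩
    exact (TwoSidedIdeal.mem_mk' ..).mpr (tensorCoeff_commutator_mem x y)
  exact (TwoSidedIdeal.mem_mk' ..).mp (hle hx) m

theorem map_mem_commutatorIdeal {C D : Type*} [Ring C] [Ring D] (f : C →+* D) {x : C}
    (hx : x ∈ commutatorIdeal C) : f x ∈ commutatorIdeal D := by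
  have hle : commutatorIdeal C ≤ (commutatorIdeal D).comap f := by
    refine TwoSidedIdeal.span_le.mpr ?_
    rintro _ ⟨x, y, rfl⟩
    refine (TwoSidedIdeal.mem_comap f).mpr ?_
    simpa using commutator_mem_commutatorIdeal (f x) (f y)
  exact (TwoSidedIdeal.mem_comap f).mp (hle hx)

variable (k A σ) in
/-- The inclusion of the polynomial ring `Z(A)[σ]` into `A ⊗[k] k[σ]`. -/
noncomputable def centerPolynomialHom :
    MvPolynomial σ (Subalgebra.center k A) →ₐ[k] A ⊗[k] MvPolynomial σ k :=
  (Algebra.TensorProduct.map (Subalgebra.center k A).val (AlgHom.id k _)).comp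
    ((MvPolynomial.algebraTensorAlgEquiv k (Subalgebra.center k A)).symm.toAlgHom.restrictScalars k)

@[simp]
theorem centerPolynomialHom_monomial (m : σ →₀ ℕ) (z : Subalgebra.center k A) :
    centerPolynomialHom k A σ (MvPolynomial.monomial m z) =
      (z : A) ⊗ₜ MvPolynomial.monomial m 1 := by
  simp [centerPolynomialHom]

@[simp]
theorem centerPolynomialHom_C (z : Subalgebra.center k A) :
    centerPolynomialHom k A σ (MvPolynomial.C z) = (z : A) ⊗ₜ 1 :=
  centerPolynomialHom_monomial 0 z

@[simp]
theorem tensorCoeff_centerPolynomialHom (m : σ →₀ ℕ)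
    (p : MvPolynomial σ (Subalgebra.center k A)) :
    tensorCoeff m (centerPolynomialHom k A σ p) = ((p.coeff m : Subalgebra.center k A) : A) := by
  classical
  induction p using MvPolynomial.induction_on' with
  | monomial d c =>
    rw [centerPolynomialHom_monomial, tensorCoeff_tmul, MvPolynomial.coeff_monomial,
      MvPolynomial.coeff_monomial]
    split_ifs <;> simp
  | add p q hp hq => simp [hp, hq]

theorem centerPolynomialHom_injective : Function.Injective (centerPolynomialHom k A σ) := by
  intro p q h
  ext m
  rw [← tensorCoeff_centerPolynomialHom, h, tensorCoeff_centerPolynomialHom]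

theorem range_centerPolynomialHom :
    (centerPolynomialHom k A σ).range = Subalgebra.center k (A ⊗[k] MvPolynomial σ k) := by
  apply le_antisymm
  · rintro _ ⟨p, rfl⟩
    change centerPolynomialHom k A σ p ∈ _
    induction p using MvPolynomial.induction_on' with
    | add p q hp hq => rw [map_add]; exact add_mem hp hq
    | monomial d z =>
      rw [centerPolynomialHom_monomial, Subalgebra.mem_center_iff]
      intro x
      induction x with
      | zero => simp
      | add x y hx hy => rw [add_mul, mul_add, hx, hy]
      | tmul b q =>
        rw [Algebra.TensorProduct.tmul_mul_tmul, Algebra.TensorProduct.tmul_mul_tmul, mul_comm q,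
          Subalgebra.mem_center_iff.mp z.2 b]
  · intro x hx
    have hx' : x ∈ Subalgebra.centralizer k ((Algebra.TensorProduct.includeLeft :
        A →ₐ[k] A ⊗[k] MvPolynomial σ k).range : Set (A ⊗[k] MvPolynomial σ k)) :=
      fun g _ => Subalgebra.mem_center_iff.mp hx g
    rw [Subalgebra.centralizer_coe_range_includeLeft_eq_center_tensorProduct] at hx'
    obtain ⟨y, rfl⟩ := hx'
    exact ⟨MvPolynomial.algebraTensorAlgEquiv k _ y, by simp [centerPolynomialHom]⟩

variable (k A σ) in
/-- The center of `A ⊗[k] k[σ]` is the polynomial ring `Z(A)[σ]`. -/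
noncomputable def centerPolynomialEquiv :
    MvPolynomial σ (Subalgebra.center k A) ≃ₐ[k]
      Subalgebra.center k (A ⊗[k] MvPolynomial σ k) :=
  (AlgEquiv.ofInjective _ centerPolynomialHom_injective).trans
    (Subalgebra.equivOfEq _ _ range_centerPolynomialHom)

theorem centerPolynomialEquiv_coe (p : MvPolynomial σ (Subalgebra.center k A)) :
    (centerPolynomialEquiv k A σ p : A ⊗[k] MvPolynomial σ k) = centerPolynomialHom k A σ p :=
  rfl

end TensorPolynomial

theorem AlgEquiv.map_center {R C D : Type*} [CommSemiring R] [Semiring C] [Semiring D]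
    [Algebra R C] [Algebra R D] (e : C ≃ₐ[R] D) :
    (Subalgebra.center R C).map e.toAlgHom = Subalgebra.center R D := by
  ext y
  simp only [Subalgebra.mem_map, Subalgebra.mem_center_iff]
  constructor
  · rintro ⟨x, hx, rfl⟩ b
    obtain ⟨b, rfl⟩ := e.surjective b
    exact (map_mul e b x).symm.trans ((congrArg e (hx b)).trans (map_mul e x b))
  · intro hy
    refine ⟨e.symm y, fun b => e.injective ?_, e.apply_symm_apply y⟩
    simpa using hy (e b)

section Isomorphism

variable {k : Type u} [Field k] {A B : Type u} [Ring A] [Algebra k A] [Ring B] [Algebra k B]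
  {σ : Type*}

/-- The isomorphism of polynomial rings over the centers induced by an isomorphism
`A ⊗[k] k[σ] ≃ B ⊗[k] k[σ]`. -/
noncomputable def centerPolynomialCongr
    (φ : (A ⊗[k] MvPolynomial σ k) ≃ₐ[k] (B ⊗[k] MvPolynomial σ k)) :
    MvPolynomial σ (Subalgebra.center k A) ≃ₐ[k] MvPolynomial σ (Subalgebra.center k B) :=
  (centerPolynomialEquiv k A σ).trans <| ((φ.subalgebraMap (Subalgebra.center k _)).trans
    (Subalgebra.equivOfEq _ _ φ.map_center)).trans (centerPolynomialEquiv k B σ).symm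

theorem centerPolynomialHom_congr
    (φ : (A ⊗[k] MvPolynomial σ k) ≃ₐ[k] (B ⊗[k] MvPolynomial σ k))
    (p : MvPolynomial σ (Subalgebra.center k A)) :
    centerPolynomialHom k B σ (centerPolynomialCongr φ p) = φ (centerPolynomialHom k A σ p) := by
  rw [← centerPolynomialEquiv_coe, centerPolynomialCongr, AlgEquiv.trans_apply,
    AlgEquiv.trans_apply, AlgEquiv.apply_symm_apply]
  rfl

theorem centerPolynomialHom_congr_symm
    (φ : (A ⊗[k] MvPolynomial σ k) ≃ₐ[k] (B ⊗[k] MvPolynomial σ k))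
    (p : MvPolynomial σ (Subalgebra.center k B)) :
    centerPolynomialHom k A σ ((centerPolynomialCongr φ).symm p) =
      φ.symm (centerPolynomialHom k B σ p) := by
  rw [AlgEquiv.eq_symm_apply, ← centerPolynomialHom_congr, AlgEquiv.apply_symm_apply]

theorem exists_center_dvd
    (φ : (A ⊗[k] MvPolynomial σ k) ≃ₐ[k] (B ⊗[k] MvPolynomial σ k))
    {t : Subalgebra.center k A} (ht : t ≠ 0) (htmem : (t : A) ∈ commutatorIdeal A)
    (hdvd : ∀ z : Subalgebra.center k A, (z : A) ∈ commutatorIdeal A → t ∣ z) :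
    ∃ w : Subalgebra.center k B, w ≠ 0 ∧
      MvPolynomial.C t ∣ (centerPolynomialCongr φ).symm (MvPolynomial.C w) := by
  have hne : centerPolynomialCongr φ (MvPolynomial.C t) ≠ 0 := by simpa using ht
  obtain ⟨m, hm⟩ := MvPolynomial.ne_zero_iff.mp hne
  refine ⟨_, hm, (MvPolynomial.C_dvd_iff_dvd_coeff _ _).mpr fun i => hdvd _ ?_⟩
  rw [← tensorCoeff_centerPolynomialHom, centerPolynomialHom_congr_symm, centerPolynomialHom_C]
  refine tensorCoeff_mem_commutatorIdeal (map_mem_commutatorIdeal φ.symm.toRingEquiv.toRingHom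
    (map_mem_commutatorIdeal (Algebra.TensorProduct.includeLeftRingHom) ?_)) i
  rw [← tensorCoeff_centerPolynomialHom, centerPolynomialHom_congr, centerPolynomialHom_C]
  exact tensorCoeff_mem_commutatorIdeal (map_mem_commutatorIdeal φ.toRingEquiv.toRingHom
    (map_mem_commutatorIdeal (Algebra.TensorProduct.includeLeftRingHom) htmem)) m

/-- A transcendental generator of the center identifies the center with `k[X]`. -/
noncomputable def polynomialEquivCenter {t : A} (ht : Transcendental k t)
    (hcen : Subalgebra.center k A = Algebra.adjoin k {t}) :
    Polynomial k ≃ₐ[k] Subalgebra.center k A :=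
  (AlgEquiv.ofInjective (Polynomial.aeval t) (transcendental_iff_injective.mp ht)).trans
    (Subalgebra.equivOfEq _ _ (by rw [hcen, Algebra.adjoin_singleton_eq_range_aeval]))

theorem polynomialEquivCenter_coe {t : A} (ht : Transcendental k t)
    (hcen : Subalgebra.center k A = Algebra.adjoin k {t}) (p : Polynomial k) :
    (polynomialEquivCenter ht hcen p : A) = Polynomial.aeval t p :=
  rfl

theorem dvd_of_mem_commutatorIdeal {t : A} (ht : Transcendental k t)
    (hcen : Subalgebra.center k A = Algebra.adjoin k {t})
    (htmem : t ∈ commutatorIdeal A) (hproper : commutatorIdeal A ≠ ⊤)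
    (z : Subalgebra.center k A) (hz : (z : A) ∈ commutatorIdeal A) :
    polynomialEquivCenter ht hcen Polynomial.X ∣ z := by
  obtain ⟨p, rfl⟩ := (polynomialEquivCenter ht hcen).surjective z
  refine map_dvd _ (Polynomial.X_dvd_iff.mpr ?_)
  by_contra hc
  refine hproper ((TwoSidedIdeal.one_mem_iff _).mp ?_)
  rw [polynomialEquivCenter_coe, ← Polynomial.divX_mul_X_add p, map_add, map_mul,
    Polynomial.aeval_X, Polynomial.aeval_C] at hz
  have h := smul_mem_twoSidedIdeal (p.coeff 0)⁻¹ ((commutatorIdeal A).sub_mem hz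
    ((commutatorIdeal A).mul_mem_left (Polynomial.aeval t p.divX) _ htmem))
  rwa [add_sub_cancel_left, Algebra.algebraMap_eq_smul_one, smul_smul, inv_mul_cancel₀ hc,
    one_smul] at h

theorem stronglyZRetractable_of_center_eq_adjoin {t : A} (ht : Transcendental k t)
    (hcen : Subalgebra.center k A = Algebra.adjoin k {t})
    (htmem : t ∈ commutatorIdeal A) (hproper : commutatorIdeal A ≠ ⊤) :
    StronglyZRetractable k A := by
  intro n _ B _ _ φ
  let e₀ := polynomialEquivCenter ht hcen
  let e := centerPolynomialCongr φ
  have hX : (e₀ Polynomial.X : A) = t := by simp [e₀, polynomialEquivCenter_coe]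
  have hZ : IsDomain (Subalgebra.center k A) := e₀.symm.toMulEquiv.isDomain (Polynomial k)
  have hW : IsDomain (MvPolynomial (Fin n) (Subalgebra.center k B)) :=
    e.symm.toMulEquiv.isDomain (MvPolynomial (Fin n) (Subalgebra.center k A))
  have : IsDomain (Subalgebra.center k B) :=
    (MvPolynomial.C_injective (Fin n) (Subalgebra.center k B)).isDomain MvPolynomial.C
  obtain ⟨w, hw, hdvd⟩ := exists_center_dvd φ (t := e₀ Polynomial.X) (by simp)
    (by rwa [hX]) (dvd_of_mem_commutatorIdeal ht hcen htmem hproper)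
  obtain ⟨h₁, h₂⟩ := MvPolynomial.map_range_C_of_algEquiv e₀ e hw hdvd
  have key {z w} (h : e (MvPolynomial.C z) = MvPolynomial.C w) :
      φ ((z : A) ⊗ₜ 1) = (w : B) ⊗ₜ 1 := by
    rw [← centerPolynomialHom_C, ← centerPolynomialHom_congr, ← centerPolynomialHom_C]
    exact congrArg _ h
  ext y
  simp only [Subalgebra.mem_map]
  constructor
  · rintro ⟨_, ⟨z, hz, rfl⟩, rfl⟩
    obtain ⟨w, hw⟩ := h₁ ⟨z, hz⟩
    exact ⟨w, w.2, (key hw).symm⟩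
  · rintro ⟨w, hw, rfl⟩
    obtain ⟨z, hz⟩ := h₂ ⟨w, hw⟩
    exact ⟨_, ⟨z, z.2, rfl⟩, key hz⟩

end Isomorphism

section Cancellation

variable {k : Type u} [Field k] {A B : Type u} [Ring A] [Algebra k A] [Ring B] [Algebra k B]
  {σ : Type*}

variable (k A) in
/-- Evaluation of an element of `A ⊗[k] k[σ]` at a point with central coordinates. -/
noncomputable def tensorEval (c : σ → Subalgebra.center k A) :
    A ⊗[k] MvPolynomial σ k →ₐ[k] A :=
  Algebra.TensorProduct.lift (AlgHom.id k A)
    ((Subalgebra.center k A).val.comp (MvPolynomial.aeval c))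
    fun a p => (Subalgebra.mem_center_iff.mp (MvPolynomial.aeval c p).2 a)

theorem tensorEval_tmul_one (c : σ → Subalgebra.center k A) (a : A) :
    tensorEval k A c (a ⊗ₜ 1) = a :=
  (Algebra.TensorProduct.lift_tmul ..).trans (by simp)

theorem tensorEval_one_tmul_X (c : σ → Subalgebra.center k A) (i : σ) :
    tensorEval k A c (1 ⊗ₜ MvPolynomial.X i) = c i :=
  (Algebra.TensorProduct.lift_tmul ..).trans (by simp)

theorem tensorEval_mem_center (c : σ → Subalgebra.center k A) {x : A ⊗[k] MvPolynomial σ k}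
    (hx : x ∈ Subalgebra.center k (A ⊗[k] MvPolynomial σ k)) :
    tensorEval k A c x ∈ Subalgebra.center k A := by
  rw [Subalgebra.mem_center_iff] at hx ⊢
  intro a
  simpa [tensorEval_tmul_one] using congrArg (tensorEval k A c) (hx (a ⊗ₜ 1))

theorem one_tmul_mem_center (p : MvPolynomial σ k) :
    (1 : A) ⊗ₜ[k] p ∈ Subalgebra.center k (A ⊗[k] MvPolynomial σ k) := by
  rw [Subalgebra.mem_center_iff]
  intro x
  induction x with
  | zero => simp
  | add x y hx hy => rw [add_mul, mul_add, hx, hy]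
  | tmul b q => simp [mul_comm]

theorem tensorPolynomial_algHom_ext {D : Type*} [Semiring D] [Algebra k D]
    {f g : A ⊗[k] MvPolynomial σ k →ₐ[k] D} (h₁ : ∀ a, f (a ⊗ₜ 1) = g (a ⊗ₜ 1))
    (h₂ : ∀ i, f (1 ⊗ₜ MvPolynomial.X i) = g (1 ⊗ₜ MvPolynomial.X i)) : f = g :=
  Algebra.TensorProduct.ext (AlgHom.ext h₁) (MvPolynomial.algHom_ext h₂)

/-- An isomorphism `A ⊗[k] k[σ] ≃ B ⊗[k] k[σ]` that carries the center of `A` onto the center of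
`B` descends to an isomorphism `A ≃ B`. -/
theorem nonempty_algEquiv_of_map_center
    (φ : (A ⊗[k] MvPolynomial σ k) ≃ₐ[k] (B ⊗[k] MvPolynomial σ k))
    (h₁ : ∀ z ∈ Subalgebra.center k A, ∃ w ∈ Subalgebra.center k B, φ (z ⊗ₜ 1) = w ⊗ₜ 1)
    (h₂ : ∀ w ∈ Subalgebra.center k B, ∃ z ∈ Subalgebra.center k A, φ (z ⊗ₜ 1) = w ⊗ₜ 1) :
    Nonempty (A ≃ₐ[k] B) := by
  have hcenter {x} (hx : x ∈ Subalgebra.center k (A ⊗[k] MvPolynomial σ k)) :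
      φ x ∈ Subalgebra.center k (B ⊗[k] MvPolynomial σ k) :=
    φ.map_center.le ⟨x, hx, rfl⟩
  have hcenter' {x} (hx : x ∈ Subalgebra.center k (B ⊗[k] MvPolynomial σ k)) :
      φ.symm x ∈ Subalgebra.center k (A ⊗[k] MvPolynomial σ k) :=
    φ.symm.map_center.le ⟨x, hx, rfl⟩
  let ε := tensorEval k A (fun _ : σ => 0)
  have hε (i : σ) : ε (φ.symm (1 ⊗ₜ MvPolynomial.X i)) ∈ Subalgebra.center k A :=
    tensorEval_mem_center _ (hcenter' (one_tmul_mem_center _))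
  choose c hc hφc using fun i => h₁ _ (hε i)
  let δ := tensorEval k B (fun i => ⟨c i, hc i⟩)
  let ψ : B →ₐ[k] A := (ε.comp φ.symm.toAlgHom).comp Algebra.TensorProduct.includeLeft
  let χ : A →ₐ[k] B := (δ.comp φ.toAlgHom).comp Algebra.TensorProduct.includeLeft
  have hψ (b : B) : ψ b = ε (φ.symm (b ⊗ₜ 1)) := rfl
  have hχ (a : A) : χ a = δ (φ (a ⊗ₜ 1)) := rfl
  have hψφ {z w} (h : φ (z ⊗ₜ 1) = w ⊗ₜ 1) : ψ w = z := by
    rw [hψ, ← h, AlgEquiv.symm_apply_apply]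
    exact tensorEval_tmul_one _ _
  have hψδ : ψ.comp δ = ε.comp φ.symm.toAlgHom := by
    refine tensorPolynomial_algHom_ext (fun b => ?_) fun i => ?_
    · exact congrArg ψ (tensorEval_tmul_one _ b)
    · exact (congrArg ψ (tensorEval_one_tmul_X _ i)).trans (hψφ (hφc i))
  have hψδ' (x) : ψ (δ x) = ε (φ.symm x) := DFunLike.congr_fun hψδ x
  have hδX (i : σ) : δ (φ (1 ⊗ₜ MvPolynomial.X i)) = 0 := by
    obtain ⟨z, -, hz⟩ := h₂ _ (tensorEval_mem_center _ (hcenter (one_tmul_mem_center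
      (MvPolynomial.X i))))
    have hz0 : z = 0 := by
      rw [← hψφ hz, hψδ', AlgEquiv.symm_apply_apply]
      exact tensorEval_one_tmul_X _ i
    rw [hz0, TensorProduct.zero_tmul, map_zero] at hz
    exact (tensorEval_tmul_one _ _).symm.trans ((congrArg δ hz).symm.trans (map_zero δ))
  have hχε : χ.comp ε = δ.comp φ.toAlgHom := by
    refine tensorPolynomial_algHom_ext (fun a => ?_) fun i => ?_
    · exact congrArg χ (tensorEval_tmul_one _ a)
    · exact ((congrArg χ (tensorEval_one_tmul_X _ i)).trans (map_zero χ)).trans (hδX i).symm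
  have hχε' (x) : χ (ε x) = δ (φ x) := DFunLike.congr_fun hχε x
  refine ⟨AlgEquiv.ofAlgHom χ ψ (AlgHom.ext fun b => ?_) (AlgHom.ext fun a => ?_)⟩
  · change χ (ψ b) = b
    rw [hψ, hχε', AlgEquiv.apply_symm_apply]
    exact tensorEval_tmul_one _ b
  · change ψ (χ a) = a
    rw [hχ, hψδ', AlgEquiv.symm_apply_apply]
    exact tensorEval_tmul_one _ a

theorem StronglyZRetractable.stronglyCancellative (h : StronglyZRetractable k A) :
    StronglyCancellative k A := by
  rintro n hn B _ _ ⟨φ⟩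
  have hmap := h n hn B φ
  refine nonempty_algEquiv_of_map_center φ (fun z hz => ?_) fun w hw => ?_
  · obtain ⟨w, hw, hzw⟩ := hmap.le ⟨_, ⟨z, hz, rfl⟩, rfl⟩
    exact ⟨w, hw, hzw.symm⟩
  · obtain ⟨_, ⟨z, hz, rfl⟩, hzw⟩ := hmap.ge ⟨w, hw, rfl⟩
    exact ⟨z, hz, hzw⟩

end Cancellation

/-- Over an algebraically closed field `k`, let `A` be a noetherian `k`-algebra such that
(i) the center of `A` is generated by a single central element `t` that is transcendental
over `k` (so `Z(A) ≅ k[t]`), (ii) `t` lies in the two-sided ideal `[A,A]` generated by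
the commutators, and (iii) `[A,A] ≠ A`. Then `A` is strongly Z-retractable and strongly
cancellative. -/
theorem statement13 (k : Type u) [Field k] [IsAlgClosed k]
    (A : Type u) [Ring A] [Algebra k A] [IsNoetherianRing A]
    (t : A) (ht : Transcendental k t)
    (hcen : Subalgebra.center k A = Algebra.adjoin k {t})
    (htmem : t ∈ commutatorIdeal A)
    (hproper : commutatorIdeal A ≠ ⊤) :
    StronglyZRetractable k A ∧ StronglyCancellative k A := by
  have h := stronglyZRetractable_of_center_eq_adjoin ht hcen htmem hproper
  exact ⟨h, h.stronglyCancellative⟩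
end
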